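/- arXiv:2306.14849 — 3 statements merged into one kernel-verified Lean document; each statement's English description precedes it below -/
import Mathlib

section
/- For every L > 1 there exists a constant C_L > 0 such that for all T, λ ∈ [1/L, L] and all real a > 0, one has |1 + H̄_T^λ(a) + 2 ν(Tλ) · (log a + (1/2) log(λ/2) + γ_EM)| ≤ C_L · a² · (1 + log⁺(1/a)). -/
open MeasureTheory Real

/-- The Volterra function `ν(x) = ∫₀^∞ x^s / Γ(s+1) ds` (for `x > 0`; `ν(0) = 0`). -/
noncomputable def volterra (x : ℝ) : ℝ := ∫ s in Set.Ioi (0 : ℝ), x ^ s / Real.Gamma (s + 1)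

/-- The Euler–Mascheroni constant `γ_EM = −∫₀^∞ e^{−x} log x dx`. -/
noncomputable def eulerGamma : ℝ := -∫ x in Set.Ioi (0 : ℝ), Real.exp (-x) * Real.log x

/-- `H̄_T^λ(a) = ∫₀^T (e^{−a²/(2r)} / r) ν((T−r)λ) dr`. -/
noncomputable def Hbar (T lam a : ℝ) : ℝ :=
  ∫ r in (0 : ℝ)..T, Real.exp (-(a ^ 2 / (2 * r))) / r * volterra ((T - r) * lam)

/-- `log⁺ u = max (log u) 0`. -/
noncomputable def logPlus (u : ℝ) : ℝ := max (Real.log u) 0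

open Set Filter Topology

/-- Each power is dominated by the Gamma function: `A ^ s ≤ e ^ A Γ(s + 1)`. -/
theorem rpow_div_Gamma_add_one_le {A s : ℝ} (hA : 0 ≤ A) (hs : 0 ≤ s) :
    A ^ s / Gamma (s + 1) ≤ exp A := by
  have hΓ : 0 < Gamma (s + 1) := Gamma_pos_of_pos (by linarith)
  rw [div_le_iff₀ hΓ, Gamma_eq_integral (by linarith)]
  have hint := GammaIntegral_convergent (s := s + 1) (by linarith)
  have h1 : ∫ t in Ioi A, exp (-t) * A ^ s ≤ ∫ t in Ioi A, exp (-t) * t ^ (s + 1 - 1) := by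
    refine setIntegral_mono_on ((integrableOn_exp_neg_Ioi A).mul_const _)
      (hint.mono_set (Ioi_subset_Ioi hA)) measurableSet_Ioi fun t ht => ?_
    have : A ^ s ≤ t ^ (s + 1 - 1) := by
      rw [add_sub_cancel_right]; exact rpow_le_rpow hA (le_of_lt ht) hs
    gcongr
  have h2 : ∫ t in Ioi A, exp (-t) * t ^ (s + 1 - 1) ≤
      ∫ t in Ioi 0, exp (-t) * t ^ (s + 1 - 1) := by
    refine setIntegral_mono_set hint ?_ (Ioi_subset_Ioi hA).eventuallyLE
    filter_upwards [ae_restrict_mem measurableSet_Ioi] with t ht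
    exact mul_nonneg (exp_pos _).le (rpow_nonneg (le_of_lt ht) _)
  rw [integral_mul_const, integral_exp_neg_Ioi] at h1
  calc A ^ s = exp A * (exp (-A) * A ^ s) := by
        rw [← mul_assoc, ← exp_add]; simp
    _ ≤ _ := by gcongr; exact h1.trans h2

theorem continuousOn_inv_Gamma_add_one :
    ContinuousOn (fun s : ℝ => (Gamma (s + 1))⁻¹) (Ioi (-1)) := by
  refine ContinuousOn.inv₀ ?_ fun s hs => (Gamma_pos_of_pos (by linarith [mem_Ioi.1 hs])).ne'
  exact differentiableOn_Gamma_Ioi.continuousOn.comp (by fun_prop)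
    fun s hs => by simp only [mem_Ioi]; linarith [mem_Ioi.1 hs]

theorem integrableOn_rpow_div_Gamma {x : ℝ} (hx : 0 ≤ x) :
    IntegrableOn (fun s : ℝ => x ^ s / Gamma (s + 1)) (Ioi 0) := by
  have hm : AEStronglyMeasurable (fun s : ℝ => x ^ s / Gamma (s + 1))
      (volume.restrict (Ioi 0)) := by
    simp_rw [div_eq_mul_inv]
    refine AEStronglyMeasurable.mul (Measurable.aestronglyMeasurable (by fun_prop)) ?_
    exact (continuousOn_inv_Gamma_add_one.mono (Ioi_subset_Ioi (by norm_num))).aestronglyMeasurable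
      measurableSet_Ioi
  refine Integrable.mono' ((integrableOn_exp_neg_Ioi 0).const_mul (exp (exp 1 * x))) hm ?_
  filter_upwards [ae_restrict_mem measurableSet_Ioi] with s hs
  have hs' : 0 < s := hs
  have hΓ : 0 < Gamma (s + 1) := Gamma_pos_of_pos (by linarith)
  have := rpow_div_Gamma_add_one_le (A := exp 1 * x) (by positivity) hs'.le
  rw [mul_rpow (exp_pos 1).le hx, ← exp_mul, one_mul] at this
  rw [norm_of_nonneg (by positivity)]
  calc x ^ s / Gamma (s + 1) = (exp s * x ^ s / Gamma (s + 1)) * exp (-s) := by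
        rw [exp_neg]; field_simp
    _ ≤ _ := by gcongr

theorem volterra_nonneg {x : ℝ} (hx : 0 ≤ x) : 0 ≤ volterra x := by
  refine setIntegral_nonneg measurableSet_Ioi fun s hs => ?_
  exact div_nonneg (rpow_nonneg hx _) (Gamma_pos_of_pos (by linarith [mem_Ioi.1 hs])).le

theorem volterra_monotoneOn : MonotoneOn volterra (Ici 0) := by
  intro x hx y hy hxy
  refine setIntegral_mono_on (integrableOn_rpow_div_Gamma hx) (integrableOn_rpow_div_Gamma hy)
    measurableSet_Ioi fun s hs => ?_
  have hs' : 0 < s := hs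
  exact div_le_div_of_nonneg_right (rpow_le_rpow hx hxy hs'.le)
    (Gamma_pos_of_pos (by linarith)).le

theorem volterra_sub_le {y z : ℝ} (hy : 0 < y) (hyz : y ≤ z) :
    volterra z - volterra y ≤ volterra (exp 1 * z) * ((z - y) / y) := by
  have hz : 0 < z := hy.trans_le hyz
  rw [volterra, volterra, volterra, ← integral_sub (integrableOn_rpow_div_Gamma hz.le)
    (integrableOn_rpow_div_Gamma hy.le), ← integral_mul_const]
  refine setIntegral_mono_on
    ((integrableOn_rpow_div_Gamma hz.le).sub (integrableOn_rpow_div_Gamma hy.le))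
    ((integrableOn_rpow_div_Gamma (by positivity)).mul_const _) measurableSet_Ioi fun s hs => ?_
  have hs' : 0 < s := hs
  have hΓ : 0 < Gamma (s + 1) := Gamma_pos_of_pos (by linarith)
  rw [← sub_div, div_mul_eq_mul_div]
  refine div_le_div_of_nonneg_right ?_ hΓ.le
  rw [mul_rpow (exp_pos 1).le hz.le, ← exp_mul, one_mul]
  have h1 : y ^ s = z ^ s * exp (s * log (y / z)) := by
    rw [log_div hy.ne' hz.ne', rpow_def_of_pos hy, rpow_def_of_pos hz, ← exp_add]
    ring_nf
  have h2 : -((z - y) / y) ≤ log (y / z) := by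
    have := log_le_sub_one_of_pos (div_pos hz hy)
    rw [← inv_div z y, log_inv]
    have e : (z - y) / y = z / y - 1 := by field_simp
    linarith
  have h3 : s * log (y / z) + 1 ≤ exp (s * log (y / z)) := add_one_le_exp _
  have h4 : s ≤ exp s := by linarith [add_one_le_exp s]
  have h5 : 0 ≤ (z - y) / y := div_nonneg (by linarith) hy.le
  have h6 : 0 < z ^ s := rpow_pos_of_pos hz s
  have h7 : 1 - exp (s * log (y / z)) ≤ exp s * ((z - y) / y) := by
    nlinarith
  calc z ^ s - y ^ s = z ^ s * (1 - exp (s * log (y / z))) := by rw [h1]; ring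
    _ ≤ z ^ s * (exp s * ((z - y) / y)) := by gcongr
    _ = _ := by ring

/-- A linear bound for the increments of the Volterra function, uniform up to the origin. -/
theorem volterra_sub_sub_le {x u : ℝ} (hx : 0 < x) (hu : 0 ≤ u) (hux : u ≤ x) :
    volterra x - volterra (x - u) ≤ 2 * volterra (exp 1 * x) / x * u := by
  have he : x ≤ exp 1 * x := by nlinarith [add_one_le_exp (1 : ℝ)]
  have hV : volterra x ≤ volterra (exp 1 * x) :=
    volterra_monotoneOn hx.le (hx.le.trans he) he
  have hV0 := volterra_nonneg hx.le
  have e : 2 * volterra (exp 1 * x) / x * u = volterra (exp 1 * x) * (2 * u / x) := by ring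
  rw [e]
  rcases le_or_gt u (x / 2) with h | h
  · have := volterra_sub_le (y := x - u) (z := x) (by linarith) (by linarith)
    refine this.trans (mul_le_mul_of_nonneg_left ?_ (hV0.trans hV))
    rw [div_le_div_iff₀ (by linarith) hx]
    nlinarith
  · have h1 : 1 ≤ 2 * u / x := by rw [le_div_iff₀ hx]; linarith
    have h2 := volterra_nonneg (x := x - u) (by linarith)
    nlinarith

theorem hasDerivAt_Gamma_one_eulerGamma : HasDerivAt Gamma (-eulerGamma) 1 := by
  have h := Complex.hasDerivAt_GammaIntegral (s := 1) (by simp)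
  have h' : HasDerivAt Complex.Gamma
      (∫ t : ℝ in Ioi 0, (t : ℂ) ^ ((1 : ℂ) - 1) * (Real.log t * Real.exp (-t))) ((1 : ℝ) : ℂ) := by
    rw [Complex.ofReal_one]
    refine h.congr_of_eventuallyEq ?_
    have : {s : ℂ | 0 < s.re} ∈ 𝓝 (1 : ℂ) :=
      (isOpen_lt continuous_const Complex.continuous_re).mem_nhds (by simp)
    filter_upwards [this] with s hs using Complex.Gamma_eq_integral hs
  refine h'.real_of_complex.congr_deriv ?_
  rw [eulerGamma, neg_neg]
  simp only [sub_self, Complex.cpow_zero, one_mul, ← Complex.ofReal_mul]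
  rw [integral_complex_ofReal, Complex.ofReal_re]
  simp only [mul_comm]

theorem integral_rpow_mul_rpow_sub {x e s : ℝ} (hx : 0 < x) (he : 0 < e) (hs : 0 < s) :
    ∫ u in Ioo 0 x, u ^ (e - 1) * ((x - u) ^ s / Gamma (s + 1)) =
      Gamma e * (x ^ (s + e) / Gamma (s + e + 1)) := by
  have h := Complex.betaIntegral_scaled (e : ℂ) ((s + 1 : ℝ) : ℂ) hx
  rw [Complex.betaIntegral_eq_Gamma_mul_div _ _ (by simpa) (by simp; linarith)] at h
  rw [intervalIntegral.integral_of_le hx.le, integral_Ioc_eq_integral_Ioo] at h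
  have h2 : ∫ u in Ioo 0 x, (u : ℂ) ^ ((e : ℂ) - 1) * ((x : ℂ) - u) ^ (((s + 1 : ℝ) : ℂ) - 1) =
      ∫ u in Ioo 0 x, ((u ^ (e - 1) * (x - u) ^ s : ℝ) : ℂ) := by
    refine setIntegral_congr_fun measurableSet_Ioo fun u hu => ?_
    rw [Complex.ofReal_mul, Complex.ofReal_cpow hu.1.le, Complex.ofReal_cpow (by linarith [hu.2])]
    push_cast
    simp
  rw [h2, integral_complex_ofReal] at h
  have h3 : ((e : ℂ) + ((s + 1 : ℝ) : ℂ) - 1) = ((s + e : ℝ) : ℂ) := by push_cast; ring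
  have h4 : ((e : ℂ) + ((s + 1 : ℝ) : ℂ)) = ((s + e + 1 : ℝ) : ℂ) := by push_cast; ring
  rw [h3, h4, Complex.Gamma_ofReal, Complex.Gamma_ofReal, Complex.Gamma_ofReal,
    ← Complex.ofReal_cpow hx.le] at h
  norm_cast at h
  have hΓ : Gamma (s + 1) ≠ 0 := (Gamma_pos_of_pos (by linarith)).ne'
  simp_rw [← mul_div_assoc]
  rw [integral_div, h]
  field_simp

theorem integral_rpow_mul_volterra_sub {x e : ℝ} (hx : 0 < x) (he : 0 < e) :
    ∫ u in Ioo 0 x, u ^ (e - 1) * volterra (x - u) =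
      Gamma e * ∫ s in Ioi e, x ^ s / Gamma (s + 1) := by
  have hu : IntegrableOn (fun u : ℝ => u ^ (e - 1)) (Ioo 0 x) :=
    (intervalIntegral.integrableOn_Ioo_rpow_iff hx).2 (by linarith)
  have hprod : Integrable (Function.uncurry fun u s : ℝ =>
      u ^ (e - 1) * ((x - u) ^ s / Gamma (s + 1)))
      ((volume.restrict (Ioo 0 x)).prod (volume.restrict (Ioi 0))) := by
    refine Integrable.mono' (hu.mul_prod (integrableOn_rpow_div_Gamma hx.le)) ?_ ?_
    · simp_rw [Function.uncurry_def, div_eq_mul_inv]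
      refine (Measurable.aestronglyMeasurable (by fun_prop)).mul
        ((Measurable.aestronglyMeasurable (by fun_prop)).mul ?_)
      exact ((continuousOn_inv_Gamma_add_one.mono
        (Ioi_subset_Ioi (by norm_num))).aestronglyMeasurable measurableSet_Ioi).comp_snd
    · rw [Measure.prod_restrict]
      filter_upwards [ae_restrict_mem (measurableSet_Ioo.prod measurableSet_Ioi)] with p hp
      obtain ⟨⟨h1, h2⟩, h3⟩ := hp
      have h3' : 0 < p.2 := h3
      have hΓ : 0 < Gamma (p.2 + 1) := Gamma_pos_of_pos (by linarith)
      have h4 : 0 ≤ (x - p.1) ^ p.2 := rpow_nonneg (by linarith) _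
      have h5 : 0 ≤ p.1 ^ (e - 1) := rpow_nonneg h1.le _
      have h6 : (x - p.1) ^ p.2 ≤ x ^ p.2 := rpow_le_rpow (by linarith) (by linarith) h3'.le
      simp only [Function.uncurry_def]
      rw [norm_of_nonneg (by positivity)]
      gcongr
  simp_rw [volterra, ← integral_const_mul]
  rw [integral_integral_swap hprod]
  have h1 : ∫ s in Ioi 0, ∫ u in Ioo 0 x, u ^ (e - 1) * ((x - u) ^ s / Gamma (s + 1)) =
      ∫ s in Ioi 0, Gamma e * (x ^ (s + e) / Gamma (s + e + 1)) :=
    setIntegral_congr_fun measurableSet_Ioi fun s hs => integral_rpow_mul_rpow_sub hx he hs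
  rw [h1, integral_const_mul, integral_const_mul]
  congr 1
  have := (measurePreserving_add_right volume e).setIntegral_preimage_emb
    (measurableEmbedding_addRight e) (fun s => x ^ s / Gamma (s + 1)) (Ioi e)
  simpa using this

theorem tendsto_rpow_sub_Gamma_div {c : ℝ} (hc : 0 < c) :
    Tendsto (fun e : ℝ => (c ^ e - Gamma (e + 1)) / e) (𝓝[>] 0) (𝓝 (log c + eulerGamma)) := by
  have h1 : HasDerivAt (fun e : ℝ => c ^ e) (log c) 0 := by
    simpa using hasStrictDerivAt_const_rpow hc 0 |>.hasDerivAt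
  have h2 : HasDerivAt (fun e : ℝ => Gamma (e + 1)) (-eulerGamma) 0 :=
    HasDerivAt.comp_add_const 0 1 (by simpa using hasDerivAt_Gamma_one_eulerGamma)
  have h3 := (h1.fun_sub h2).tendsto_slope_zero_right
  rw [sub_neg_eq_add] at h3
  refine h3.congr fun e => ?_
  simp [div_eq_inv_mul]

theorem tendsto_average_rpow_div_Gamma {x : ℝ} (hx : 0 < x) :
    Tendsto (fun e : ℝ => (∫ s in (0 : ℝ)..e, x ^ s / Gamma (s + 1)) / e) (𝓝[>] 0) (𝓝 1) := by
  have hc : ContinuousOn (fun s : ℝ => x ^ s / Gamma (s + 1)) (Ioi (-1)) := by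
    simp_rw [div_eq_mul_inv]
    exact (continuous_const_rpow hx.ne').continuousOn.mul continuousOn_inv_Gamma_add_one
  have h0 : Ioi (-1 : ℝ) ∈ 𝓝 0 := Ioi_mem_nhds (by norm_num)
  have h := (intervalIntegral.integral_hasDerivAt_right (a := (0 : ℝ)) (b := 0)
    (f := fun s : ℝ => x ^ s / Gamma (s + 1)) (by simp)
    (hc.stronglyMeasurableAtFilter isOpen_Ioi 0 (by simp))
    (hc.continuousAt h0)).tendsto_slope_zero_right
  have e1 : x ^ (0 : ℝ) / Gamma (0 + 1) = 1 := by simp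
  rw [e1] at h
  refine h.congr fun e => ?_
  simp [div_eq_inv_mul]

theorem integrableOn_volterra_slope {x : ℝ} (hx : 0 < x) :
    IntegrableOn (fun u => (volterra x - volterra (x - u)) / u) (Ioo 0 x) := by
  have hm : AEStronglyMeasurable (fun u => volterra (x - u)) (volume.restrict (Ioo 0 x)) := by
    refine (aemeasurable_restrict_of_antitoneOn measurableSet_Ioo ?_).aestronglyMeasurable
    intro u hu v hv huv
    exact volterra_monotoneOn (by simp only [mem_Ici]; linarith [hv.2])
      (by simp only [mem_Ici]; linarith [hu.2]) (by linarith)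
  refine Integrable.of_bound ?_ (2 * volterra (exp 1 * x) / x) ?_
  · simp_rw [div_eq_mul_inv]
    exact (aestronglyMeasurable_const.sub hm).mul measurable_inv.aestronglyMeasurable
  · filter_upwards [ae_restrict_mem measurableSet_Ioo] with u hu
    have h1 := volterra_monotoneOn (a := x - u) (b := x) (by simp only [mem_Ici]; linarith [hu.2])
      hx.le (by linarith [hu.1])
    rw [norm_of_nonneg (div_nonneg (by linarith) hu.1.le), div_le_iff₀ hu.1]
    exact volterra_sub_sub_le hx hu.1.le hu.2.le

theorem integral_volterra_slope {x : ℝ} (hx : 0 < x) :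
    ∫ u in Ioo 0 x, (volterra x - volterra (x - u)) / u =
      1 + volterra x * (log x + eulerGamma) := by
  set g : ℝ → ℝ := fun u => (volterra x - volterra (x - u)) / u with hg
  have hgint : IntegrableOn g (Ioo 0 x) := integrableOn_volterra_slope hx
  have hIoc : Ioc (0 : ℝ) 1 ∈ 𝓝[>] 0 := Ioc_mem_nhdsGT one_pos
  have hlim : Tendsto (fun e : ℝ => ∫ u in Ioo 0 x, u ^ e * g u) (𝓝[>] 0)
      (𝓝 (∫ u in Ioo 0 x, g u)) := by
    refine tendsto_integral_filter_of_dominated_convergence (fun u => (1 + x) * ‖g u‖) ?_ ?_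
      (hgint.norm.const_mul _) ?_
    · exact Eventually.of_forall fun e =>
        (Measurable.aestronglyMeasurable (by fun_prop)).mul hgint.aestronglyMeasurable
    · filter_upwards [hIoc] with e he
      filter_upwards [ae_restrict_mem measurableSet_Ioo] with u hu
      rw [norm_mul, norm_of_nonneg (rpow_nonneg hu.1.le _)]
      gcongr
      calc u ^ e ≤ (1 + x) ^ e := rpow_le_rpow hu.1.le (by linarith [hu.2]) he.1.le
        _ ≤ (1 + x) ^ (1 : ℝ) := rpow_le_rpow_of_exponent_le (by linarith) he.2
        _ = 1 + x := rpow_one _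
    · filter_upwards [ae_restrict_mem measurableSet_Ioo] with u hu
      have : Tendsto (fun e : ℝ => u ^ e) (𝓝[>] 0) (𝓝 (u ^ (0 : ℝ))) :=
        (continuous_const_rpow hu.1.ne').continuousAt.tendsto.mono_left nhdsWithin_le_nhds
      simpa using this.mul_const (g u)
  have hΓ : Tendsto (fun e : ℝ => Gamma (e + 1)) (𝓝[>] 0) (𝓝 1) := by
    have h2 : HasDerivAt (fun e : ℝ => Gamma (e + 1)) (-eulerGamma) 0 :=
      HasDerivAt.comp_add_const 0 1 (by simpa using hasDerivAt_Gamma_one_eulerGamma)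
    simpa using h2.continuousAt.tendsto.mono_left (nhdsWithin_le_nhds (s := Ioi 0))
  have hlim2 := ((hΓ.mul (tendsto_average_rpow_div_Gamma hx)).add
    ((tendsto_rpow_sub_Gamma_div hx).const_mul (volterra x)))
  rw [one_mul] at hlim2
  refine tendsto_nhds_unique (hlim.congr' ?_) hlim2
  filter_upwards [hIoc] with e he
  have he0 : 0 < e := he.1
  have hu : IntegrableOn (fun u : ℝ => u ^ (e - 1)) (Ioo 0 x) :=
    (intervalIntegral.integrableOn_Ioo_rpow_iff hx).2 (by linarith)
  have hpt : ∀ u ∈ Ioo 0 x,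
      u ^ (e - 1) * volterra (x - u) = u ^ (e - 1) * volterra x - u ^ e * g u := by
    intro u hu
    rw [hg, rpow_sub_one hu.1.ne']
    have := hu.1.ne'
    field_simp
    ring
  have hug : IntegrableOn (fun u : ℝ => u ^ e * g u) (Ioo 0 x) := by
    refine Integrable.bdd_mul (c := (1 + x) ^ e) hgint
      (Measurable.aestronglyMeasurable (by fun_prop)) ?_
    filter_upwards [ae_restrict_mem measurableSet_Ioo] with u hu
    rw [norm_of_nonneg (rpow_nonneg hu.1.le _)]
    exact rpow_le_rpow hu.1.le (by linarith [hu.2]) he0.le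
  have h1 := integral_rpow_mul_volterra_sub hx he0
  rw [setIntegral_congr_fun measurableSet_Ioo hpt, integral_sub (hu.mul_const _) hug,
    integral_mul_const] at h1
  have h2 : ∫ u in Ioo 0 x, u ^ (e - 1) = x ^ e / e := by
    rw [← integral_Ioc_eq_integral_Ioo, ← intervalIntegral.integral_of_le hx.le,
      integral_rpow (Or.inl (by linarith))]
    simp [he0.ne']
  have h3 : (∫ s in (0 : ℝ)..e, x ^ s / Gamma (s + 1)) + ∫ s in Ioi e, x ^ s / Gamma (s + 1) =
      volterra x := by
    rw [volterra, intervalIntegral.integral_of_le he0.le, ← setIntegral_union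
      (Ioc_disjoint_Ioi le_rfl) measurableSet_Ioi, Ioc_union_Ioi_eq_Ioi he0.le]
    · exact (integrableOn_rpow_div_Gamma hx.le).mono_set Ioc_subset_Ioi_self
    · exact (integrableOn_rpow_div_Gamma hx.le).mono_set (Ioi_subset_Ioi he0.le)
  rw [h2] at h1
  rw [Gamma_add_one he0.ne', ← h3]
  rw [← h3] at h1
  field_simp
  field_simp at h1
  linarith

/-- The exponential integral `E₁(c) = ∫_c^∞ e^{-t} / t dt` equals `-log c - γ` up to an error
in `[0, c]`. -/
theorem exponentialIntegral_add_log_mem_Icc {c : ℝ} (hc : 0 < c) :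
    (∫ t in Ioi c, exp (-t) / t) + (log c + eulerGamma) ∈ Icc 0 c := by
  have hIoc : Ioc (0 : ℝ) 1 ∈ 𝓝[>] 0 := Ioc_mem_nhdsGT one_pos
  have hlim : Tendsto (fun e : ℝ => ∫ t in Ioi c, exp (-t) * t ^ (e - 1)) (𝓝[>] 0)
      (𝓝 (∫ t in Ioi c, exp (-t) / t)) := by
    refine tendsto_integral_filter_of_dominated_convergence (fun t => exp (-t) * (1 / c + 1)) ?_ ?_
      ((integrableOn_exp_neg_Ioi c).mul_const _) ?_
    · exact Eventually.of_forall fun e => Measurable.aestronglyMeasurable (by fun_prop)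
    · filter_upwards [hIoc] with e he
      filter_upwards [ae_restrict_mem measurableSet_Ioi] with t ht
      have ht' : c < t := ht
      have ht0 : 0 < t := hc.trans ht'
      rw [norm_of_nonneg (mul_nonneg (exp_pos _).le (rpow_nonneg ht0.le _))]
      gcongr
      have h1 : t ^ e ≤ 1 + t := by
        calc t ^ e ≤ (1 + t) ^ e := rpow_le_rpow ht0.le (by linarith) he.1.le
          _ ≤ (1 + t) ^ (1 : ℝ) := rpow_le_rpow_of_exponent_le (by linarith) he.2
          _ = 1 + t := rpow_one _
      calc t ^ (e - 1) = t ^ e / t := rpow_sub_one ht0.ne' e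
        _ ≤ (1 + t) / t := by gcongr
        _ = 1 / t + 1 := by field_simp
        _ ≤ 1 / c + 1 := by gcongr
    · filter_upwards [ae_restrict_mem measurableSet_Ioi] with t ht
      have ht0 : 0 < t := hc.trans ht
      have : Tendsto (fun e : ℝ => t ^ e) (𝓝[>] 0) (𝓝 (t ^ (0 : ℝ))) :=
        (continuous_const_rpow ht0.ne').continuousAt.tendsto.mono_left nhdsWithin_le_nhds
      rw [rpow_zero] at this
      have := this.const_mul (exp (-t) / t)
      rw [mul_one] at this
      refine this.congr fun e => ?_
      rw [rpow_sub_one ht0.ne']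
      ring
  have hlim2 := hlim.add (tendsto_rpow_sub_Gamma_div hc)
  have hub : Tendsto (fun e : ℝ => c ^ (e + 1)) (𝓝[>] 0) (𝓝 c) := by
    have : Continuous fun e : ℝ => c ^ (e + 1) :=
      (continuous_const_rpow hc.ne').comp (by fun_prop)
    simpa using (this.tendsto 0).mono_left (nhdsWithin_le_nhds (s := Ioi 0))
  have key : ∀ e : ℝ, 0 < e →
      (∫ t in Ioi c, exp (-t) * t ^ (e - 1)) + (c ^ e - Gamma (e + 1)) / e ∈
        Icc 0 (c ^ (e + 1)) := by
    intro e he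
    have hpow : IntegrableOn (fun t : ℝ => t ^ (e - 1)) (Ioc 0 c) :=
      (intervalIntegral.intervalIntegrable_rpow' (by linarith)).1
    have hpow2 : IntegrableOn (fun t : ℝ => t ^ e) (Ioc 0 c) :=
      (intervalIntegral.intervalIntegrable_rpow' (by linarith)).1
    have hΓ := GammaIntegral_convergent he
    have hexp : IntegrableOn (fun t : ℝ => exp (-t) * t ^ (e - 1)) (Ioc 0 c) :=
      hΓ.mono_set Ioc_subset_Ioi_self
    have h1 : (∫ t in Ioc 0 c, exp (-t) * t ^ (e - 1)) + ∫ t in Ioi c, exp (-t) * t ^ (e - 1) =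
        Gamma e := by
      rw [Gamma_eq_integral he, ← setIntegral_union (Ioc_disjoint_Ioi le_rfl) measurableSet_Ioi
        hexp (hΓ.mono_set (Ioi_subset_Ioi hc.le)), Ioc_union_Ioi_eq_Ioi hc.le]
    have h2 : ∫ t in Ioc 0 c, t ^ (e - 1) = c ^ e / e := by
      rw [← intervalIntegral.integral_of_le hc.le, integral_rpow (Or.inl (by linarith))]
      simp [he.ne']
    have h3 : ∫ t in Ioc 0 c, t ^ e = c ^ (e + 1) / (e + 1) := by
      rw [← intervalIntegral.integral_of_le hc.le, integral_rpow (Or.inl (by linarith))]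
      simp [(by linarith : e + 1 ≠ 0)]
    have h4 : ∫ t in Ioc 0 c, exp (-t) * t ^ (e - 1) ≤ ∫ t in Ioc 0 c, t ^ (e - 1) := by
      refine setIntegral_mono_on hexp hpow measurableSet_Ioc fun t ht => ?_
      exact mul_le_of_le_one_left (rpow_nonneg ht.1.le _) (exp_le_one_iff.2 (by linarith [ht.1]))
    have h5 : (∫ t in Ioc 0 c, t ^ (e - 1)) - ∫ t in Ioc 0 c, t ^ e ≤
        ∫ t in Ioc 0 c, exp (-t) * t ^ (e - 1) := by
      rw [← integral_sub hpow hpow2]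
      refine setIntegral_mono_on (hpow.sub hpow2) hexp measurableSet_Ioc fun t ht => ?_
      have ht0 := ht.1.ne'
      have e1 : t ^ e = t * t ^ (e - 1) := by rw [rpow_sub_one ht0]; field_simp
      have := mul_le_mul_of_nonneg_right (one_sub_le_exp_neg t) (rpow_nonneg ht.1.le (e - 1))
      rw [e1]
      linarith
    have h6 : c ^ (e + 1) / (e + 1) ≤ c ^ (e + 1) :=
      div_le_self (rpow_nonneg hc.le _) (by linarith)
    rw [h2] at h4 h5
    rw [h3] at h5
    rw [Gamma_add_one he.ne', sub_div, mul_div_cancel_left₀ _ he.ne']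
    constructor <;> linarith
  constructor
  · refine ge_of_tendsto hlim2 ?_
    filter_upwards [self_mem_nhdsWithin] with e he using (key e he).1
  · refine le_of_tendsto_of_tendsto hlim2 hub ?_
    filter_upwards [self_mem_nhdsWithin] with e he using (key e he).2

theorem integral_exp_neg_div_div {x b : ℝ} (hx : 0 < x) (hb : 0 < b) :
    ∫ u in Ioo 0 x, exp (-(b / u)) / u = ∫ t in Ioi (b / x), exp (-t) / t := by
  have himg : (fun u => b / u) '' Ioo 0 x = Ioi (b / x) := by
    ext t
    simp only [mem_image, mem_Ioo, mem_Ioi]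
    constructor
    · rintro ⟨u, ⟨h1, h2⟩, rfl⟩
      gcongr
    · intro ht
      have ht0 : 0 < t := (div_pos hb hx).trans ht
      refine ⟨b / t, ⟨by positivity, ?_⟩, by field_simp⟩
      rw [div_lt_iff₀ hx] at ht
      rw [div_lt_iff₀ ht0]
      linarith
  have hderiv : ∀ u ∈ Ioo 0 x, HasDerivWithinAt (fun u => b / u) (-(b / u ^ 2)) (Ioo 0 x) u := by
    intro u hu
    have := ((hasDerivAt_inv hu.1.ne').const_mul b).hasDerivWithinAt (s := Ioo 0 x)
    simpa [div_eq_mul_inv] using this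
  have hinj : InjOn (fun u => b / u) (Ioo 0 x) := by
    intro u hu v hv huv
    have := hu.1.ne'
    have := hv.1.ne'
    simp only at huv
    field_simp at huv
    exact huv.symm
  rw [← himg, integral_image_eq_integral_abs_deriv_smul measurableSet_Ioo hderiv hinj]
  refine setIntegral_congr_fun measurableSet_Ioo fun u hu => ?_
  have hu0 := hu.1
  simp only [abs_neg, smul_eq_mul]
  rw [abs_of_pos (by positivity)]
  field_simp

theorem integrableOn_exp_neg_div_div {x b : ℝ} (hb : 0 < b) :
    IntegrableOn (fun u : ℝ => exp (-(b / u)) / u) (Ioo 0 x) := by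
  refine Measure.integrableOn_of_bounded (M := 1 / b) (by simp)
    (Measurable.aestronglyMeasurable (by fun_prop)) ?_
  filter_upwards [ae_restrict_mem measurableSet_Ioo] with u hu
  have hu0 := hu.1
  rw [norm_of_nonneg (by positivity), exp_neg, div_le_div_iff₀ hu0 hb, one_mul]
  have : b / u ≤ exp (b / u) := by linarith [add_one_le_exp (b / u)]
  rw [inv_mul_le_iff₀ (exp_pos _)]
  rw [div_le_iff₀ hu0] at this
  exact this

theorem one_sub_exp_neg_div_le {b u : ℝ} (hb : 0 < b) (hu : 0 < u) :
    1 - exp (-(b / u)) ≤ 2 * b * (u + b)⁻¹ := by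
  rw [← div_eq_mul_inv, le_div_iff₀ (by linarith)]
  have h1 : 1 - exp (-(b / u)) ≤ b / u := by linarith [one_sub_le_exp_neg (b / u)]
  have h2 : (1 - exp (-(b / u))) * u ≤ b := (le_div_iff₀ hu).1 h1
  have h3 := exp_pos (-(b / u))
  nlinarith

theorem integral_inv_add {x b : ℝ} (hx : 0 < x) (hb : 0 < b) :
    ∫ u in Ioo 0 x, (u + b)⁻¹ = log (1 + x / b) := by
  rw [← integral_Ioc_eq_integral_Ioo, ← intervalIntegral.integral_of_le hx.le,
    intervalIntegral.integral_comp_add_right (fun u => u⁻¹),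
    integral_inv_of_pos (by linarith) (by linarith)]
  congr 1
  field_simp
  ring

/-- The asymptotics of `∫₀ˣ e^{-b/u} u⁻¹ ν(x - u) du` as `b → 0`: the remainder is nonnegative and
explicitly bounded. -/
theorem volterra_convolution_mem_Icc {x b : ℝ} (hx : 0 < x) (hb : 0 < b) :
    1 + (∫ u in Ioo 0 x, exp (-(b / u)) / u * volterra (x - u)) +
        volterra x * (log b + 2 * eulerGamma) ∈
      Icc 0 (volterra (exp 1 * x) / x * b * (4 * log (1 + x / b) + 1)) := by
  set g : ℝ → ℝ := fun u => (volterra x - volterra (x - u)) / u with hg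
  have hgint : IntegrableOn g (Ioo 0 x) := integrableOn_volterra_slope hx
  have hI := integrableOn_exp_neg_div_div (x := x) hb
  have hh : ∀ u ∈ Ioo 0 x, exp (-(b / u)) ∈ Icc 0 1 := fun u hu =>
    ⟨(exp_pos _).le, exp_le_one_iff.2 (by have := hu.1; simp only [Left.neg_nonpos_iff]; positivity)⟩
  have hhg : IntegrableOn (fun u => exp (-(b / u)) * g u) (Ioo 0 x) := by
    refine Integrable.bdd_mul (c := 1) hgint (Measurable.aestronglyMeasurable (by fun_prop)) ?_
    filter_upwards [ae_restrict_mem measurableSet_Ioo] with u hu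
    rw [norm_of_nonneg (exp_pos _).le]
    exact (hh u hu).2
  have hpt : ∀ u ∈ Ioo 0 x, exp (-(b / u)) / u * volterra (x - u) =
      exp (-(b / u)) / u * volterra x - exp (-(b / u)) * g u := by
    intro u hu
    rw [hg]
    ring
  have hsplit : 1 + (∫ u in Ioo 0 x, exp (-(b / u)) / u * volterra (x - u)) +
      volterra x * (log b + 2 * eulerGamma) =
      (∫ u in Ioo 0 x, (1 - exp (-(b / u))) * g u) + volterra x *
        ((∫ t in Ioi (b / x), exp (-t) / t) + (log (b / x) + eulerGamma)) := by
    have h1 := integral_volterra_slope hx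
    rw [setIntegral_congr_fun measurableSet_Ioo hpt, integral_sub (hI.mul_const _) hhg,
      integral_mul_const, integral_exp_neg_div_div hx hb, log_div hb.ne' hx.ne']
    simp_rw [sub_mul, one_mul]
    rw [integral_sub hgint hhg, h1]
    ring
  have hg0 : ∀ u ∈ Ioo 0 x, 0 ≤ g u := fun u hu => by
    have := volterra_monotoneOn (a := x - u) (b := x) (by simp only [mem_Ici]; linarith [hu.2])
      hx.le (by linarith [hu.1])
    exact div_nonneg (by linarith) hu.1.le
  have hgle : ∀ u ∈ Ioo 0 x, g u ≤ 2 * volterra (exp 1 * x) / x := fun u hu => by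
    rw [div_le_iff₀ hu.1]
    exact volterra_sub_sub_le hx hu.1.le hu.2.le
  have hpos : 0 ≤ ∫ u in Ioo 0 x, (1 - exp (-(b / u))) * g u :=
    setIntegral_nonneg measurableSet_Ioo fun u hu =>
      mul_nonneg (by linarith [(hh u hu).2]) (hg0 u hu)
  have hinv : IntegrableOn (fun u : ℝ => (u + b)⁻¹) (Ioo 0 x) := by
    refine Measure.integrableOn_of_bounded (M := b⁻¹) (by simp)
      (Measurable.aestronglyMeasurable (by fun_prop)) ?_
    filter_upwards [ae_restrict_mem measurableSet_Ioo] with u hu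
    have := hu.1
    rw [norm_of_nonneg (by positivity)]
    gcongr
    linarith
  have hle : ∫ u in Ioo 0 x, (1 - exp (-(b / u))) * g u ≤
      ∫ u in Ioo 0 x, 2 * b * (2 * volterra (exp 1 * x) / x) * (u + b)⁻¹ := by
    refine setIntegral_mono_on ?_ (hinv.const_mul _) measurableSet_Ioo fun u hu => ?_
    · simp_rw [sub_mul, one_mul]
      exact hgint.sub hhg
    · have h1 := one_sub_exp_neg_div_le hb hu.1
      have h2 : 0 ≤ 1 - exp (-(b / u)) := by linarith [(hh u hu).2]
      calc (1 - exp (-(b / u))) * g u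
          ≤ (2 * b * (u + b)⁻¹) * (2 * volterra (exp 1 * x) / x) :=
            mul_le_mul h1 (hgle u hu) (hg0 u hu) (h2.trans h1)
        _ = _ := by ring
  rw [integral_const_mul, integral_inv_add hx hb] at hle
  have hE := exponentialIntegral_add_log_mem_Icc (div_pos hb hx)
  have hV0 := volterra_nonneg hx.le
  have he : x ≤ exp 1 * x := by nlinarith [add_one_le_exp (1 : ℝ)]
  have hV : volterra x ≤ volterra (exp 1 * x) := volterra_monotoneOn hx.le (hx.le.trans he) he
  rw [hsplit]
  constructor
  · exact add_nonneg hpos (mul_nonneg hV0 hE.1)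
  · calc _ ≤ 2 * b * (2 * volterra (exp 1 * x) / x) * log (1 + x / b) +
          volterra (exp 1 * x) * (b / x) :=
          add_le_add hle (mul_le_mul hV hE.2 hE.1 (hV0.trans hV))
      _ = _ := by ring

theorem Hbar_eq_integral {T lam : ℝ} (hT : 0 < T) (hlam : 0 < lam) (a : ℝ) :
    Hbar T lam a = ∫ u in Ioo 0 (T * lam),
      exp (-(a ^ 2 * lam / 2 / u)) / u * volterra (T * lam - u) := by
  rw [← integral_Ioc_eq_integral_Ioo, ← intervalIntegral.integral_of_le (by positivity)]
  have := intervalIntegral.smul_integral_comp_mul_right (a := 0) (b := T)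
    (fun u => exp (-(a ^ 2 * lam / 2 / u)) / u * volterra (T * lam - u)) lam
  rw [zero_mul] at this
  rw [← this, Hbar, ← intervalIntegral.integral_smul]
  congr 1
  ext r
  have e : a ^ 2 * lam / 2 / (r * lam) = a ^ 2 / (2 * r) := by
    rw [div_div, ← mul_assoc, mul_div_mul_right _ _ hlam.ne']
  rw [smul_eq_mul, ← sub_mul, ← mul_assoc, e, ← mul_div_assoc, mul_comm r lam,
    mul_div_mul_left _ _ hlam.ne']

theorem log_one_add_div_sq_le {L a : ℝ} (hL : 0 ≤ L) (ha : 0 < a) :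
    log (1 + 2 * L / a ^ 2) ≤ log (1 + 2 * L) + 2 * logPlus (1 / a) := by
  rcases le_or_gt 1 a with h | h
  · have h1 : 2 * L / a ^ 2 ≤ 2 * L := div_le_self (by positivity) (one_le_pow₀ h)
    have h2 : log (1 + 2 * L / a ^ 2) ≤ log (1 + 2 * L) := log_le_log (by positivity) (by linarith)
    have h3 : 0 ≤ logPlus (1 / a) := le_max_right _ _
    linarith
  · have h1 : 1 + 2 * L / a ^ 2 ≤ (1 + 2 * L) * (1 / a) ^ 2 := by
      have : 1 ≤ (1 / a) ^ 2 := one_le_pow₀ (by rw [le_div_iff₀ ha]; linarith)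
      calc 1 + 2 * L / a ^ 2 ≤ (1 / a) ^ 2 + 2 * L / a ^ 2 := by linarith
        _ = _ := by field_simp
    have h2 := log_le_log (by positivity) h1
    rw [log_mul (by positivity) (by positivity), log_pow] at h2
    have h3 : log (1 / a) ≤ logPlus (1 / a) := le_max_left _ _
    push_cast at h2
    linarith

/-- For every `L > 1` there is `C_L > 0` such that for all `T, λ ∈ [1/L, L]` and `a > 0`:
`|1 + H̄_T^λ(a) + 2 ν(Tλ)(log a + ½ log(λ/2) + γ_EM)| ≤ C_L a² (1 + log⁺(1/a))`. -/
theorem Hbar_near_origin_approx (L : ℝ) (hL : 1 < L) :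
    ∃ C > 0, ∀ T lam a : ℝ,
      T ∈ Set.Icc (1 / L) L → lam ∈ Set.Icc (1 / L) L → 0 < a →
      |1 + Hbar T lam a
          + 2 * volterra (T * lam) * (Real.log a + (1 / 2) * Real.log (lam / 2) + eulerGamma)|
        ≤ C * a ^ 2 * (1 + logPlus (1 / a)) := by
  have hL0 : 0 < L := by linarith
  have hlogL : 0 ≤ log (1 + 2 * L) := log_nonneg (by linarith)
  have hV0 : 0 ≤ volterra (exp 1 * L ^ 2) := volterra_nonneg (by positivity)
  refine ⟨(volterra (exp 1 * L ^ 2) + 1) * L ^ 2 * (L / 2) * (4 * log (1 + 2 * L) + 9),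
    by positivity, fun T lam a hT hlam ha => ?_⟩
  have hT0 : 0 < T := (by positivity : (0 : ℝ) < 1 / L).trans_le hT.1
  have hlam0 : 0 < lam := (by positivity : (0 : ℝ) < 1 / L).trans_le hlam.1
  have hb : 0 < a ^ 2 * lam / 2 := by positivity
  have hx : 0 < T * lam := mul_pos hT0 hlam0
  have hlog : 2 * (log a + 1 / 2 * log (lam / 2) + eulerGamma) =
      log (a ^ 2 * lam / 2) + 2 * eulerGamma := by
    rw [mul_div_assoc, log_mul (by positivity) (by positivity), log_pow]
    push_cast
    ring
  have hmain := volterra_convolution_mem_Icc hx hb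
  rw [← Hbar_eq_integral hT0 hlam0, ← hlog] at hmain
  have hcomm : 2 * volterra (T * lam) * (log a + 1 / 2 * log (lam / 2) + eulerGamma) =
    volterra (T * lam) * (2 * (log a + 1 / 2 * log (lam / 2) + eulerGamma)) := by ring
  rw [hcomm, abs_of_nonneg hmain.1]
  refine hmain.2.trans ?_
  have hVle : volterra (exp 1 * (T * lam)) ≤ volterra (exp 1 * L ^ 2) + 1 := by
    have hTl : T * lam ≤ L ^ 2 := by
      rw [sq]; exact mul_le_mul hT.2 hlam.2 hlam0.le hL0.le
    have h1 : exp 1 * (T * lam) ≤ exp 1 * L ^ 2 := by gcongr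
    have := volterra_monotoneOn (mem_Ici.2 (by positivity)) (mem_Ici.2 (by positivity)) h1
    linarith
  have hxinv : (T * lam)⁻¹ ≤ L ^ 2 := by
    rw [mul_inv, sq]
    have h1 : T⁻¹ ≤ L := by rw [inv_le_comm₀ hT0 hL0, ← one_div]; exact hT.1
    have h2 : lam⁻¹ ≤ L := by rw [inv_le_comm₀ hlam0 hL0, ← one_div]; exact hlam.1
    exact mul_le_mul h1 h2 (by positivity) hL0.le
  have hble : a ^ 2 * lam / 2 ≤ L / 2 * a ^ 2 := by nlinarith [hlam.2, sq_nonneg a]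
  have hlogle : log (1 + T * lam / (a ^ 2 * lam / 2)) ≤
      log (1 + 2 * L) + 2 * logPlus (1 / a) := by
    refine (log_le_log (by positivity) ?_).trans (log_one_add_div_sq_le hL0.le ha)
    have : T * lam / (a ^ 2 * lam / 2) = 2 * T / a ^ 2 := by field_simp
    rw [this]
    gcongr
    exact hT.2
  have hlp : 0 ≤ logPlus (1 / a) := le_max_right _ _
  have hlog0 : 0 ≤ log (1 + T * lam / (a ^ 2 * lam / 2)) :=
    log_nonneg (by linarith [div_pos hx hb])
  have hV1 : 0 ≤ volterra (exp 1 * (T * lam)) := volterra_nonneg (by positivity)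
  calc volterra (exp 1 * (T * lam)) / (T * lam) * (a ^ 2 * lam / 2) *
        (4 * log (1 + T * lam / (a ^ 2 * lam / 2)) + 1)
      ≤ (volterra (exp 1 * L ^ 2) + 1) * L ^ 2 * (L / 2 * a ^ 2) *
        ((4 * log (1 + 2 * L) + 9) * (1 + logPlus (1 / a))) := by
        rw [div_eq_mul_inv]
        gcongr
        nlinarith [mul_nonneg hlogL hlp]
    _ = _ := by ring
end

section
/- For all fixed T > 0 and a > 0, the drift magnitude λ ↦ b̄_T^λ(a) := −(d/da H̄_T^λ(a)) / (1 + H̄_T^λ(a)) is strictly increasing in λ on (0,∞) (equivalently, its partial derivative in λ is strictly positive for all T, a, λ > 0). Moreover, for every L > 1 there exists a constant C_L > 0 such that for all T, a, λ > 0 with Tλ ≤ L, λ · (∂/∂λ) b̄_T^λ(a) ≤ (C_L / a) · ( (e^{−a²/(2T)} / (1 + log⁺(1/(Tλ)))²) if a² ≥ 2T²λ, and (1 / (1 + log⁺(2T/a²))²) if a² < 2T²λ ). -/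
open MeasureTheory Real

/-- The drift magnitude `b̄_T^λ(a) = −(d/da H̄_T^λ(a)) / (1 + H̄_T^λ(a))`. -/
noncomputable def bbar (T lam a : ℝ) : ℝ :=
  -(deriv (fun a' => Hbar T lam a') a) / (1 + Hbar T lam a)

/-- The moments `∫₀^∞ s^j x^s / Γ(s+1) ds`; the zeroth one is the Volterra function. -/
noncomputable def volterraMoment (j : ℕ) (x : ℝ) : ℝ :=
  ∫ s in Set.Ioi (0 : ℝ), s ^ j * (x ^ s / Real.Gamma (s + 1))

lemma volterraMoment_zero_left (x : ℝ) : volterraMoment 0 x = volterra x := by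
  simp [volterraMoment, volterra]

lemma volterraMoment_zero_right (j : ℕ) : volterraMoment j 0 = 0 := by
  unfold volterraMoment
  refine setIntegral_eq_zero_of_forall_eq_zero fun s hs => ?_
  simp [Real.zero_rpow (ne_of_gt (Set.mem_Ioi.mp hs))]

lemma rpow_div_Gamma_nonneg {x s : ℝ} (hx : 0 ≤ x) (hs : 0 ≤ s) :
    0 ≤ x ^ s / Real.Gamma (s + 1) :=
  div_nonneg (Real.rpow_nonneg hx _) (Real.Gamma_nonneg_of_nonneg (by linarith))

lemma rpow_div_Gamma_le_exp {x s : ℝ} (hx : 0 ≤ x) (hs : 0 ≤ s) :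
    x ^ s / Real.Gamma (s + 1) ≤ Real.exp x := by
  have hG : 0 < Real.Gamma (s + 1) := Real.Gamma_pos_of_pos (by linarith)
  have h_int : IntegrableOn (fun t : ℝ => Real.exp (-t) * t ^ (s + 1 - 1)) (Set.Ioi 0) :=
    Real.GammaIntegral_convergent (by linarith)
  have hsub : Set.Ioi x ⊆ Set.Ioi (0 : ℝ) := Set.Ioi_subset_Ioi hx
  have hle : Real.exp (-x) * x ^ s ≤ Real.Gamma (s + 1) := by
    rw [Real.Gamma_eq_integral (by linarith : 0 < s + 1), ← integral_exp_neg_Ioi x,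
      ← integral_mul_const]
    calc ∫ t in Set.Ioi x, Real.exp (-t) * x ^ s
        ≤ ∫ t in Set.Ioi x, Real.exp (-t) * t ^ (s + 1 - 1) := by
          refine setIntegral_mono_on ((integrableOn_exp_neg_Ioi x).mul_const _)
            (h_int.mono_set hsub) measurableSet_Ioi fun t ht => ?_
          have htx : x < t := ht
          rw [add_sub_cancel_right]
          gcongr
      _ ≤ _ := by
          refine setIntegral_mono_set h_int ?_ hsub.eventuallyLE
          filter_upwards [ae_restrict_mem measurableSet_Ioi] with t ht
          have ht0 : (0 : ℝ) < t := ht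
          simp only [Pi.zero_apply]
          positivity
  rw [div_le_iff₀ hG]
  calc x ^ s = Real.exp x * (Real.exp (-x) * x ^ s) := by
        rw [← mul_assoc, ← Real.exp_add]; simp
    _ ≤ _ := by gcongr

lemma rpow_div_Gamma_le_exp_mul {x y m s : ℝ} (hx : 0 ≤ x) (hs : 0 ≤ s)
    (hy : x * Real.exp m ≤ y) :
    x ^ s / Real.Gamma (s + 1) ≤ Real.exp y * Real.exp (-(m * s)) := by
  have h1 := rpow_div_Gamma_le_exp (mul_nonneg hx (Real.exp_pos m).le) hs
  rw [Real.mul_rpow hx (Real.exp_pos m).le, ← Real.exp_mul, mul_div_right_comm] at h1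
  calc x ^ s / Real.Gamma (s + 1)
      = x ^ s / Real.Gamma (s + 1) * Real.exp (m * s) * Real.exp (-(m * s)) := by
        rw [mul_assoc, ← Real.exp_add]; simp
    _ ≤ _ := by
        have := h1.trans (Real.exp_le_exp.mpr hy)
        gcongr

lemma integrableOn_pow_mul_exp_neg (j : ℕ) {m : ℝ} (hm : 0 < m) :
    IntegrableOn (fun s : ℝ => s ^ j * Real.exp (-(m * s))) (Set.Ioi 0) := by
  have := integrableOn_rpow_mul_exp_neg_mul_rpow (p := 1) (s := j) (b := m)
    (by have : (0 : ℝ) ≤ j := j.cast_nonneg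
        linarith) one_pos hm
  refine this.congr_fun (fun s _ => ?_) measurableSet_Ioi
  simp

lemma integral_pow_mul_exp_neg (j : ℕ) {m : ℝ} (hm : 0 < m) :
    ∫ s in Set.Ioi (0 : ℝ), s ^ j * Real.exp (-(m * s)) = j.factorial / m ^ (j + 1) := by
  have := Real.integral_rpow_mul_exp_neg_mul_Ioi (a := (j : ℝ) + 1) (r := m) (by positivity) hm
  rw [Real.Gamma_nat_eq_factorial] at this
  simp only [add_sub_cancel_right, Real.rpow_natCast] at this
  rw [this, show ((j : ℝ) + 1) = ((j + 1 : ℕ) : ℝ) by push_cast; ring, Real.rpow_natCast,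
    one_div, inv_pow, inv_mul_eq_div]

lemma continuousOn_volterraMoment_integrand (j : ℕ) {x : ℝ} (hx : 0 < x) :
    ContinuousOn (fun s : ℝ => s ^ j * (x ^ s / Real.Gamma (s + 1))) (Set.Ioi 0) := by
  intro s hs
  have hs0 : (0 : ℝ) < s := hs
  have hG : ContinuousAt (fun s : ℝ => Real.Gamma (s + 1)) s := by
    refine ContinuousAt.comp (g := Real.Gamma)
      (Real.differentiableAt_Gamma fun m => ?_).continuousAt (by fun_prop)
    have : (0 : ℝ) ≤ m := m.cast_nonneg
    linarith
  have hG0 : Real.Gamma (s + 1) ≠ 0 := (Real.Gamma_pos_of_pos (by linarith)).ne'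
  have hp : ContinuousAt (fun s : ℝ => x ^ s) s := Real.continuousAt_const_rpow hx.ne'
  exact ((continuous_pow j).continuousAt.mul (hp.div hG hG0)).continuousWithinAt

lemma integrableOn_volterraMoment_integrand (j : ℕ) {x : ℝ} (hx : 0 < x) :
    IntegrableOn (fun s : ℝ => s ^ j * (x ^ s / Real.Gamma (s + 1))) (Set.Ioi 0) := by
  refine Integrable.mono' ((integrableOn_pow_mul_exp_neg j one_pos).const_mul
    (Real.exp (x * Real.exp 1)))
    ((continuousOn_volterraMoment_integrand j hx).aestronglyMeasurable measurableSet_Ioi) ?_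
  filter_upwards [ae_restrict_mem measurableSet_Ioi] with s hs
  have hs0 : (0 : ℝ) < s := hs
  have h0 := rpow_div_Gamma_nonneg hx.le hs0.le
  rw [Real.norm_of_nonneg (by positivity)]
  have := rpow_div_Gamma_le_exp_mul hx.le hs0.le (le_refl (x * Real.exp 1))
  calc s ^ j * (x ^ s / Real.Gamma (s + 1))
      ≤ s ^ j * (Real.exp (x * Real.exp 1) * Real.exp (-(1 * s))) := by gcongr
    _ = _ := by ring

lemma volterraMoment_nonneg (j : ℕ) {x : ℝ} (hx : 0 ≤ x) : 0 ≤ volterraMoment j x := by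
  refine setIntegral_nonneg measurableSet_Ioi fun s hs => ?_
  have hs0 : (0 : ℝ) < s := hs
  exact mul_nonneg (by positivity) (rpow_div_Gamma_nonneg hx hs0.le)

lemma volterraMoment_pos (j : ℕ) {x : ℝ} (hx : 0 < x) : 0 < volterraMoment j x := by
  have hpos : ∀ s ∈ Set.Ioi (0 : ℝ), 0 < s ^ j * (x ^ s / Real.Gamma (s + 1)) := by
    intro s hs
    have hs0 : (0 : ℝ) < s := hs
    have hG := Real.Gamma_pos_of_pos (by linarith : 0 < s + 1)
    positivity
  unfold volterraMoment
  rw [setIntegral_pos_iff_support_of_nonneg_ae]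
  · rw [Set.inter_eq_right.mpr fun s hs => Function.mem_support.mpr (hpos s hs).ne']
    simp
  · filter_upwards [ae_restrict_mem measurableSet_Ioi] with s hs using (hpos s hs).le
  · exact integrableOn_volterraMoment_integrand j hx

lemma monotoneOn_volterraMoment (j : ℕ) : MonotoneOn (volterraMoment j) (Set.Ici 0) := by
  intro x hx y hy hxy
  rcases eq_or_lt_of_le (Set.mem_Ici.mp hx) with rfl | hx
  · rw [volterraMoment_zero_right]
    exact volterraMoment_nonneg j hy
  refine setIntegral_mono_on (integrableOn_volterraMoment_integrand j hx)
    (integrableOn_volterraMoment_integrand j (hx.trans_le hxy)) measurableSet_Ioi fun s hs => ?_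
  have hs0 : (0 : ℝ) < s := hs
  have hG := Real.Gamma_pos_of_pos (by linarith : 0 < s + 1)
  gcongr

lemma hasDerivAt_volterraMoment (j : ℕ) {x : ℝ} (hx : 0 < x) :
    HasDerivAt (volterraMoment j) (volterraMoment (j + 1) x / x) x := by
  have key := hasDerivAt_integral_of_dominated_loc_of_deriv_le
    (μ := volume.restrict (Set.Ioi (0 : ℝ))) (s := Set.Ioo (x / 2) (2 * x)) (x₀ := x)
    (F := fun (x s : ℝ) => s ^ j * (x ^ s / Real.Gamma (s + 1)))
    (F' := fun (x s : ℝ) => s ^ (j + 1) * (x ^ s / Real.Gamma (s + 1)) / x)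
    (bound := fun s => s ^ (j + 1) * ((2 * x) ^ s / Real.Gamma (s + 1)) / (x / 2))
    (Ioo_mem_nhds (by linarith) (by linarith))
    (by
      filter_upwards [lt_mem_nhds hx] with y hy
      exact (integrableOn_volterraMoment_integrand j hy).aestronglyMeasurable)
    (integrableOn_volterraMoment_integrand j hx)
    ((integrableOn_volterraMoment_integrand (j + 1) hx).div_const x).aestronglyMeasurable
    (by
      filter_upwards [ae_restrict_mem measurableSet_Ioi] with s hs y hy
      have hs0 : (0 : ℝ) < s := hs
      have hy0 : 0 < y := by linarith [hy.1]
      have hG := Real.Gamma_pos_of_pos (by linarith : 0 < s + 1)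
      rw [Real.norm_of_nonneg (by positivity)]
      have := hy.1.le
      have := hy.2.le
      gcongr)
    ((integrableOn_volterraMoment_integrand (j + 1) (by positivity : 0 < 2 * x)).div_const _)
    (by
      filter_upwards [ae_restrict_mem measurableSet_Ioi] with s hs y hy
      have hy0 : 0 < y := by linarith [hy.1]
      have h := ((Real.hasDerivAt_rpow_const (x := y) (p := s) (Or.inl hy0.ne')).div_const
        (Real.Gamma (s + 1))).const_mul (s ^ j)
      refine h.congr_deriv ?_
      rw [Real.rpow_sub_one hy0.ne']
      ring)
  have h2 := key.2
  rw [integral_div] at h2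
  exact h2

lemma volterraMoment_mul_le {x y : ℝ} (hy : 0 < y) (hyx : y ≤ x) :
    volterraMoment 0 x * volterraMoment 1 y ≤ volterraMoment 1 x * volterraMoment 0 y := by
  have hx : 0 < x := hy.trans_le hyx
  have h0y := volterraMoment_pos 0 hy
  set m := volterraMoment 1 y / volterraMoment 0 y with hm
  have hlin : ∀ z : ℝ, 0 < z →
      (∫ s in Set.Ioi (0 : ℝ), (s - m) * (z ^ s / Real.Gamma (s + 1)))
        = volterraMoment 1 z - m * volterraMoment 0 z := by
    intro z hz
    unfold volterraMoment
    rw [← integral_const_mul, ← integral_sub (integrableOn_volterraMoment_integrand 1 hz)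
      ((integrableOn_volterraMoment_integrand 0 hz).const_mul m)]
    congr 1; ext s; ring
  have h_int : ∀ z : ℝ, 0 < z →
      IntegrableOn (fun s => (s - m) * (z ^ s / Real.Gamma (s + 1))) (Set.Ioi 0) := by
    intro z hz
    refine ((integrableOn_volterraMoment_integrand 1 hz).sub
      ((integrableOn_volterraMoment_integrand 0 hz).const_mul m)).congr_fun (fun s _ => ?_)
      measurableSet_Ioi
    simp only [Pi.sub_apply]; ring
  have hle : (x / y) ^ m * (volterraMoment 1 y - m * volterraMoment 0 y)
      ≤ volterraMoment 1 x - m * volterraMoment 0 x := by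
    rw [← hlin x hx, ← hlin y hy, ← integral_const_mul]
    refine setIntegral_mono_on ((h_int y hy).const_mul _) (h_int x hx) measurableSet_Ioi
      fun s hs => ?_
    have hs0 : (0 : ℝ) < s := hs
    have hG := Real.Gamma_pos_of_pos (by linarith : 0 < s + 1)
    have hxy1 : 1 ≤ x / y := (one_le_div hy).mpr hyx
    have hxs : x ^ s = (x / y) ^ s * y ^ s := by
      rw [← Real.mul_rpow (by positivity) hy.le, div_mul_cancel₀ _ hy.ne']
    have hkey : (s - m) * (x / y) ^ m ≤ (s - m) * (x / y) ^ s := by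
      rcases le_total m s with h | h
      · exact mul_le_mul_of_nonneg_left (Real.rpow_le_rpow_of_exponent_le hxy1 h) (by linarith)
      · exact mul_le_mul_of_nonpos_left (Real.rpow_le_rpow_of_exponent_le hxy1 h) (by linarith)
    have hq : 0 ≤ y ^ s / Real.Gamma (s + 1) := by positivity
    calc _ = (s - m) * (x / y) ^ m * (y ^ s / Real.Gamma (s + 1)) := by ring
      _ ≤ (s - m) * (x / y) ^ s * (y ^ s / Real.Gamma (s + 1)) := by gcongr
      _ = _ := by rw [hxs]; ring
  have hz : volterraMoment 1 y - m * volterraMoment 0 y = 0 := by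
    rw [hm]; field_simp; ring
  rw [hz, mul_zero] at hle
  have h1 : volterraMoment 1 y = m * volterraMoment 0 y := by linarith
  rw [h1]
  nlinarith

lemma volterraMoment_sub_le {x θ : ℝ} (hx : 0 < x) (hθ0 : 0 ≤ θ) (hθ1 : θ < 1) :
    volterraMoment 1 x - volterraMoment 1 ((1 - θ) * x)
      ≤ θ * (volterraMoment 1 x + volterraMoment 2 x) := by
  have hi1 := integrableOn_volterraMoment_integrand 1 hx
  have hi2 := integrableOn_volterraMoment_integrand 2 hx
  have hi3 := integrableOn_volterraMoment_integrand 1 (mul_pos (by linarith : 0 < 1 - θ) hx)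
  unfold volterraMoment
  rw [← integral_sub hi1 hi3, ← integral_add hi1 hi2, ← integral_const_mul]
  refine setIntegral_mono_on (hi1.sub hi3) ((hi1.add hi2).const_mul θ) measurableSet_Ioi
    fun s hs => ?_
  have hs0 : (0 : ℝ) < s := hs
  have hG := Real.Gamma_pos_of_pos (by linarith : 0 < s + 1)
  have hB := one_add_mul_self_le_rpow_one_add (s := -θ) (by linarith) (p := s + 1) (by linarith)
  have hle : (1 + -θ) ^ (s + 1) ≤ (1 - θ) ^ s := by
    rw [← sub_eq_add_neg]
    exact Real.rpow_le_rpow_of_exponent_ge (by linarith) (by linarith) (by linarith)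
  have hq : 0 ≤ s * (x ^ s / Real.Gamma (s + 1)) := by positivity
  rw [Real.mul_rpow (by linarith) hx.le]
  calc _ = (1 - (1 - θ) ^ s) * (s * (x ^ s / Real.Gamma (s + 1))) := by ring
    _ ≤ ((s + 1) * θ) * (s * (x ^ s / Real.Gamma (s + 1))) :=
        mul_le_mul_of_nonneg_right (by linarith) hq
    _ = _ := by ring

lemma logPlus_nonneg (u : ℝ) : 0 ≤ logPlus u := le_max_right _ _

lemma volterraMoment_le (j : ℕ) {x L : ℝ} (hx : 0 < x) (hxL : x ≤ L) (hL : 1 ≤ L) :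
    volterraMoment j x
      ≤ Real.exp (L * Real.exp 1) * (j.factorial / (1 + logPlus (1 / x)) ^ (j + 1)) := by
  have hm : 0 < 1 + logPlus (1 / x) := by linarith [logPlus_nonneg (1 / x)]
  have hxe : x * Real.exp (1 + logPlus (1 / x)) ≤ L * Real.exp 1 := by
    have h : x * Real.exp (logPlus (1 / x)) ≤ L := by
      rcases max_choice (Real.log (1 / x)) 0 with h | h
      · rw [logPlus, h, Real.exp_log (by positivity)]
        rwa [mul_one_div_cancel hx.ne']
      · rw [logPlus, h]; simpa using hxL
    rw [Real.exp_add]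
    calc _ = x * Real.exp (logPlus (1 / x)) * Real.exp 1 := by ring
      _ ≤ _ := by gcongr
  rw [← integral_pow_mul_exp_neg j hm, ← integral_const_mul]
  refine setIntegral_mono_on (integrableOn_volterraMoment_integrand j hx)
    ((integrableOn_pow_mul_exp_neg j hm).const_mul _) measurableSet_Ioi fun s hs => ?_
  have hs0 : (0 : ℝ) < s := hs
  have := rpow_div_Gamma_le_exp_mul hx.le hs0.le hxe
  calc _ ≤ s ^ j * (Real.exp (L * Real.exp 1) * Real.exp (-((1 + logPlus (1 / x)) * s))) := by
        gcongr
    _ = _ := by ring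

lemma Gamma_add_one_le_one {s : ℝ} (h0 : 0 ≤ s) (h1 : s ≤ 1) : Real.Gamma (s + 1) ≤ 1 := by
  have := Real.convexOn_Gamma.2 (show (1 : ℝ) ∈ Set.Ioi 0 by simp)
    (show (2 : ℝ) ∈ Set.Ioi 0 by simp) (show 0 ≤ 1 - s by linarith) h0 (by ring)
  simp only [smul_eq_mul, Real.Gamma_one, Real.Gamma_two] at this
  calc Real.Gamma (s + 1) = Real.Gamma ((1 - s) * 1 + s * 2) := by congr 1; ring
    _ ≤ _ := by linarith

lemma le_volterraMoment_zero_half {x : ℝ} (hx : 0 < x) :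
    1 / (2 * Real.exp 1) ≤ (1 + logPlus (1 / x)) * volterraMoment 0 (x / 2) := by
  have hl := logPlus_nonneg (1 / x)
  set m := 1 + logPlus (1 / x) with hm
  have hm1 : 1 ≤ m := by linarith
  have hm0 : 0 < m := by linarith
  have hlow : ∀ s ∈ Set.Ioc (0 : ℝ) (1 / m),
      1 / (2 * Real.exp 1) ≤ s ^ 0 * ((x / 2) ^ s / Real.Gamma (s + 1)) := by
    intro s hs
    have hs0 := hs.1
    have hsm : s * m ≤ 1 := (le_div_iff₀ hm0).mp hs.2
    have hs1 : s ≤ 1 := hs.2.trans ((div_le_one hm0).mpr hm1)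
    have hG := Real.Gamma_pos_of_pos (by linarith : 0 < s + 1)
    have hG1 := Gamma_add_one_le_one hs0.le hs1
    have hxs : Real.exp (-1) ≤ x ^ s := by
      rw [Real.rpow_def_of_pos hx]
      refine Real.exp_le_exp.mpr ?_
      have : -Real.log x ≤ m := by
        have := le_max_left (Real.log (1 / x)) 0
        rw [one_div, Real.log_inv] at this
        rw [hm, logPlus, one_div, Real.log_inv]
        linarith
      nlinarith
    have h2s : (2 : ℝ) ^ s ≤ 2 := by
      simpa using Real.rpow_le_rpow_of_exponent_le (by norm_num : (1 : ℝ) ≤ 2) hs1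
    rw [pow_zero, one_mul, Real.div_rpow hx.le (by norm_num)]
    calc 1 / (2 * Real.exp 1) = Real.exp (-1) / 2 := by rw [Real.exp_neg]; field_simp
      _ ≤ x ^ s / 2 ^ s := by gcongr
      _ ≤ _ := by
        rw [le_div_iff₀ hG]
        exact mul_le_of_le_one_right (by positivity) hG1
  have hsub : Set.Ioc (0 : ℝ) (1 / m) ⊆ Set.Ioi 0 := fun s hs => hs.1
  have h_int := integrableOn_volterraMoment_integrand 0 (by positivity : 0 < x / 2)
  have hle : 1 / m * (1 / (2 * Real.exp 1)) ≤ volterraMoment 0 (x / 2) := by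
    calc 1 / m * (1 / (2 * Real.exp 1))
        = ∫ _ in Set.Ioc (0 : ℝ) (1 / m), 1 / (2 * Real.exp 1) := by
          rw [setIntegral_const, Real.volume_real_Ioc_of_le (by positivity)]; simp
      _ ≤ ∫ s in Set.Ioc (0 : ℝ) (1 / m), s ^ 0 * ((x / 2) ^ s / Real.Gamma (s + 1)) :=
          setIntegral_mono_on (integrableOn_const measure_Ioc_lt_top.ne) (h_int.mono_set hsub)
            measurableSet_Ioc hlow
      _ ≤ _ := by
          refine setIntegral_mono_set h_int ?_ hsub.eventuallyLE
          filter_upwards [ae_restrict_mem measurableSet_Ioi] with s hs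
          have hs0 : (0 : ℝ) < s := hs
          exact mul_nonneg (by positivity) (rpow_div_Gamma_nonneg (by positivity) hs0.le)
  calc 1 / (2 * Real.exp 1) = m * (1 / m * (1 / (2 * Real.exp 1))) := by field_simp
    _ ≤ _ := by gcongr

/-- The heat-type weight `e^{-a²/(2r)} / r^n`. -/
noncomputable def heatWeight (n : ℕ) (a r : ℝ) : ℝ := Real.exp (-(a ^ 2 / (2 * r))) / r ^ n

lemma heatWeight_pos (n : ℕ) (a : ℝ) {r : ℝ} (hr : 0 < r) : 0 < heatWeight n a r := by
  unfold heatWeight; positivity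

lemma heatWeight_le (n : ℕ) {a r : ℝ} (ha : 0 < a) (hr : 0 < r) :
    heatWeight n a r ≤ n.factorial * (2 / a ^ 2) ^ n := by
  have h := Real.pow_div_factorial_le_exp (a ^ 2 / (2 * r)) (by positivity) n
  rw [div_le_iff₀ (by positivity)] at h
  have hr' : (r ^ n)⁻¹ = (a ^ 2 / (2 * r)) ^ n * (2 / a ^ 2) ^ n := by
    rw [← mul_pow, ← inv_pow]
    congr 1
    field_simp
  calc heatWeight n a r
      = Real.exp (-(a ^ 2 / (2 * r))) * (a ^ 2 / (2 * r)) ^ n * (2 / a ^ 2) ^ n := by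
        rw [heatWeight, div_eq_mul_inv, hr', mul_assoc]
    _ ≤ Real.exp (-(a ^ 2 / (2 * r))) * (Real.exp (a ^ 2 / (2 * r)) * n.factorial) *
        (2 / a ^ 2) ^ n := by gcongr
    _ = _ := by rw [← mul_assoc (Real.exp _), ← Real.exp_add]; simp

lemma measurable_heatWeight (n : ℕ) (a : ℝ) : Measurable (heatWeight n a) := by
  unfold heatWeight; fun_prop

lemma intervalIntegrable_heatWeight (n : ℕ) {a T : ℝ} (ha : 0 < a) (hT : 0 < T) :
    IntervalIntegrable (heatWeight n a) volume 0 T := by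
  refine IntervalIntegrable.mono_fun' (g := fun _ => n.factorial * (2 / a ^ 2) ^ n)
    intervalIntegrable_const (measurable_heatWeight n a).aestronglyMeasurable ?_
  rw [Set.uIoc_of_le hT.le]
  filter_upwards [ae_restrict_mem measurableSet_Ioc] with r hr
  rw [Real.norm_of_nonneg (heatWeight_pos n a hr.1).le]
  exact heatWeight_le n ha hr.1

lemma aemeasurable_volterraMoment_comp (j : ℕ) {T lam : ℝ} (hT : 0 < T) (hlam : 0 < lam) :
    AEMeasurable (fun r => volterraMoment j ((T - r) * lam))
      (volume.restrict (Set.uIoc 0 T)) := by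
  rw [Set.uIoc_of_le hT.le]
  refine aemeasurable_restrict_of_antitoneOn measurableSet_Ioc fun r hr t ht hrt => ?_
  refine monotoneOn_volterraMoment j (mul_nonneg (by linarith [ht.2]) hlam.le)
    (mul_nonneg (by linarith [hr.2]) hlam.le) ?_
  gcongr

lemma volterraMoment_comp_mem (j : ℕ) {T lam r : ℝ} (hlam : 0 < lam) (hr : r ∈ Set.Ioc 0 T) :
    0 ≤ volterraMoment j ((T - r) * lam) ∧
      volterraMoment j ((T - r) * lam) ≤ volterraMoment j (T * lam) := by
  have h0 : 0 ≤ (T - r) * lam := mul_nonneg (by linarith [hr.2]) hlam.le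
  have hle : (T - r) * lam ≤ T * lam := by
    have := hr.1
    gcongr
    linarith
  exact ⟨volterraMoment_nonneg j h0, monotoneOn_volterraMoment j h0 (h0.trans hle) hle⟩

lemma intervalIntegrable_mul_volterraMoment (j : ℕ) {W : ℝ → ℝ} {T lam : ℝ} (hT : 0 < T)
    (hlam : 0 < lam) (hW : IntervalIntegrable W volume 0 T) :
    IntervalIntegrable (fun r => W r * volterraMoment j ((T - r) * lam)) volume 0 T := by
  refine IntervalIntegrable.mono_fun' (g := fun r => ‖W r‖ * volterraMoment j (T * lam))
    (hW.norm.mul_const _)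
    (hW.aestronglyMeasurable_restrict_uIoc.mul
      (aemeasurable_volterraMoment_comp j hT hlam).aestronglyMeasurable) ?_
  filter_upwards [ae_restrict_mem measurableSet_uIoc] with r hr
  rw [Set.uIoc_of_le hT.le] at hr
  obtain ⟨h0, h1⟩ := volterraMoment_comp_mem j hlam hr
  rw [norm_mul, Real.norm_of_nonneg h0]
  gcongr

/-- The integrals `∫₀^T e^{-a²/(2r)} r^{-n} V_j((T-r)λ) dr`, with `V_j` the Volterra moments. -/
noncomputable def heatVolterra (n j : ℕ) (T lam a : ℝ) : ℝ :=
  ∫ r in (0 : ℝ)..T, heatWeight n a r * volterraMoment j ((T - r) * lam)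

lemma Hbar_eq_heatVolterra (T lam a : ℝ) : Hbar T lam a = heatVolterra 1 0 T lam a := by
  simp [Hbar, heatVolterra, heatWeight, volterraMoment_zero_left]

lemma intervalIntegrable_heatVolterra (n j : ℕ) {T lam a : ℝ} (hT : 0 < T) (hlam : 0 < lam)
    (ha : 0 < a) :
    IntervalIntegrable (fun r => heatWeight n a r * volterraMoment j ((T - r) * lam))
      volume 0 T :=
  intervalIntegrable_mul_volterraMoment j hT hlam (intervalIntegrable_heatWeight n ha hT)

lemma heatVolterra_pos (n j : ℕ) {T lam a : ℝ} (hT : 0 < T) (hlam : 0 < lam) (ha : 0 < a) :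
    0 < heatVolterra n j T lam a :=
  intervalIntegral.intervalIntegral_pos_of_pos_on
    (intervalIntegrable_heatVolterra n j hT hlam ha)
    (fun r hr => mul_pos (heatWeight_pos n a hr.1)
      (volterraMoment_pos j (mul_pos (by linarith [hr.2]) hlam))) hT

lemma hasDerivAt_heatVolterra_lam (n j : ℕ) {T lam a : ℝ} (hT : 0 < T) (hlam : 0 < lam)
    (ha : 0 < a) :
    HasDerivAt (fun l => heatVolterra n j T l a) (heatVolterra n (j + 1) T lam a / lam) lam := by
  have hlam2 : 0 < 2 * lam := by positivity
  have key := intervalIntegral.hasDerivAt_integral_of_dominated_loc_of_deriv_le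
    (μ := volume) (a := 0) (b := T) (s := Set.Ioo (lam / 2) (2 * lam)) (x₀ := lam)
    (F := fun l r => heatWeight n a r * volterraMoment j ((T - r) * l))
    (F' := fun l r => heatWeight n a r * volterraMoment (j + 1) ((T - r) * l) / l)
    (bound := fun r => heatWeight n a r * volterraMoment (j + 1) (T * (2 * lam)) / (lam / 2))
    (Ioo_mem_nhds (by linarith) (by linarith))
    (by
      filter_upwards [lt_mem_nhds hlam] with l hl
      exact (intervalIntegrable_heatVolterra n j hT hl ha).aestronglyMeasurable_restrict_uIoc)
    (intervalIntegrable_heatVolterra n j hT hlam ha)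
    ((intervalIntegrable_heatVolterra n (j + 1) hT hlam ha).div_const
      lam).aestronglyMeasurable_restrict_uIoc
    (by
      refine Filter.Eventually.of_forall fun r hr l hl => ?_
      rw [Set.uIoc_of_le hT.le] at hr
      have hl0 : 0 < l := by linarith [hl.1]
      have hw := heatWeight_pos n a hr.1
      obtain ⟨h0, h1⟩ := volterraMoment_comp_mem (j + 1) hl0 hr
      rw [Real.norm_of_nonneg (by positivity)]
      have h2 : volterraMoment (j + 1) (T * l) ≤ volterraMoment (j + 1) (T * (2 * lam)) := by
        refine monotoneOn_volterraMoment (j + 1) (Set.mem_Ici.mpr (by positivity))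
          (Set.mem_Ici.mpr (by positivity)) ?_
        have := hl.2.le
        gcongr
      have h3 := hl.1.le
      have h4 := h1.trans h2
      have h5 := h0.trans h4
      gcongr)
    (((intervalIntegrable_heatWeight n ha hT).mul_const _).div_const _)
    (by
      refine Filter.Eventually.of_forall fun r hr l hl => ?_
      rw [Set.uIoc_of_le hT.le] at hr
      have hl0 : 0 < l := by linarith [hl.1]
      rcases eq_or_lt_of_le hr.2 with rfl | hrT
      · simpa [volterraMoment_zero_right] using hasDerivAt_const l (0 : ℝ)
      · have hTr : 0 < T - r := by linarith
        have h1 : HasDerivAt (fun l : ℝ => (T - r) * l) (T - r) l := by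
          simpa using (hasDerivAt_id l).const_mul (T - r)
        have h2 := ((hasDerivAt_volterraMoment j (mul_pos hTr hl0)).comp l h1).const_mul
          (heatWeight n a r)
        refine h2.congr_deriv ?_
        field_simp)
  have h2 := key.2
  rw [intervalIntegral.integral_div] at h2
  exact h2

lemma hasDerivAt_heatWeight (n : ℕ) (a : ℝ) {r : ℝ} (hr : r ≠ 0) :
    HasDerivAt (fun b => heatWeight n b r) (-a * heatWeight (n + 1) a r) a := by
  have h := ((((hasDerivAt_id a).pow 2).div_const (2 * r)).neg.exp).div_const (r ^ n)
  refine h.congr_deriv ?_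
  simp only [heatWeight, id, Pi.pow_apply, Pi.neg_apply]
  field_simp
  push_cast
  ring

lemma hasDerivAt_heatVolterra (n j : ℕ) {T lam a : ℝ} (hT : 0 < T) (hlam : 0 < lam)
    (ha : 0 < a) :
    HasDerivAt (fun b => heatVolterra n j T lam b) (-a * heatVolterra (n + 1) j T lam a) a := by
  have key := intervalIntegral.hasDerivAt_integral_of_dominated_loc_of_deriv_le
    (μ := volume) (a := 0) (b := T) (s := Set.Ioo (a / 2) (2 * a)) (x₀ := a)
    (F := fun b r => heatWeight n b r * volterraMoment j ((T - r) * lam))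
    (F' := fun b r => -b * (heatWeight (n + 1) b r * volterraMoment j ((T - r) * lam)))
    (bound := fun r => 2 * a * (heatWeight (n + 1) (a / 2) r *
      volterraMoment j ((T - r) * lam)))
    (Ioo_mem_nhds (by linarith) (by linarith))
    (by
      filter_upwards [lt_mem_nhds ha] with b hb
      exact (intervalIntegrable_heatVolterra n j hT hlam hb).aestronglyMeasurable_restrict_uIoc)
    (intervalIntegrable_heatVolterra n j hT hlam ha)
    ((intervalIntegrable_heatVolterra (n + 1) j hT hlam ha).const_mul
      (-a)).aestronglyMeasurable_restrict_uIoc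
    (by
      refine Filter.Eventually.of_forall fun r hr b hb => ?_
      rw [Set.uIoc_of_le hT.le] at hr
      have hr0 := hr.1
      have hb0 : 0 < b := by linarith [hb.1]
      have hw := heatWeight_pos (n + 1) b hr0
      obtain ⟨h0, -⟩ := volterraMoment_comp_mem j hlam hr
      rw [neg_mul, norm_neg, Real.norm_of_nonneg (by positivity)]
      have hb2 := hb.2.le
      have hb1 := hb.1.le
      have hle : heatWeight (n + 1) b r ≤ heatWeight (n + 1) (a / 2) r := by
        unfold heatWeight
        gcongr
      gcongr)
    ((intervalIntegrable_heatVolterra (n + 1) j hT hlam (half_pos ha)).const_mul _)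
    (by
      refine Filter.Eventually.of_forall fun r hr b _ => ?_
      rw [Set.uIoc_of_le hT.le] at hr
      refine ((hasDerivAt_heatWeight n b hr.1.ne').mul_const _).congr_deriv ?_
      ring)
  have h2 := key.2
  rw [intervalIntegral.integral_const_mul] at h2
  exact h2

lemma bbar_eq {T lam a : ℝ} (hT : 0 < T) (hlam : 0 < lam) (ha : 0 < a) :
    bbar T lam a = a * heatVolterra 2 0 T lam a / (1 + heatVolterra 1 0 T lam a) := by
  simp only [bbar, Hbar_eq_heatVolterra]
  rw [(hasDerivAt_heatVolterra 1 0 hT hlam ha).deriv]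
  simp

lemma hasDerivAt_bbar {T lam a : ℝ} (hT : 0 < T) (hlam : 0 < lam) (ha : 0 < a) :
    HasDerivAt (fun l => bbar T l a)
      (a * (heatVolterra 2 1 T lam a * (1 + heatVolterra 1 0 T lam a)
        - heatVolterra 2 0 T lam a * heatVolterra 1 1 T lam a)
        / (1 + heatVolterra 1 0 T lam a) ^ 2 / lam) lam := by
  have hpos := heatVolterra_pos 1 0 hT hlam ha
  have h := ((hasDerivAt_heatVolterra_lam 2 0 hT hlam ha).const_mul a).div
    ((hasDerivAt_heatVolterra_lam 1 0 hT hlam ha).const_add 1) (by positivity)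
  refine (h.congr_deriv ?_).congr_of_eventuallyEq ?_
  · field_simp
  · filter_upwards [lt_mem_nhds hlam] with l hl
    exact bbar_eq hT hl ha

lemma integral_heatWeight_two {T a : ℝ} (hT : 0 < T) (ha : 0 < a) :
    ∫ r in (0 : ℝ)..T, heatWeight 2 a r = 2 / a ^ 2 * Real.exp (-(a ^ 2 / (2 * T))) := by
  have hd : ∀ r : ℝ, 0 < r → HasDerivAt
      (fun r => 2 / a ^ 2 * Real.exp (-(a ^ 2 / (2 * r)))) (heatWeight 2 a r) r := by
    intro r hr
    have h1 : HasDerivAt (fun r : ℝ => -(a ^ 2 / (2 * r))) (a ^ 2 / (2 * r ^ 2)) r := by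
      have := ((hasDerivAt_const r (a ^ 2)).div ((hasDerivAt_id r).const_mul 2)
        (by simp [hr.ne'])).neg
      refine this.congr_deriv ?_
      simp only [id]
      field_simp
      ring
    refine (h1.exp.const_mul (2 / a ^ 2)).congr_deriv ?_
    rw [heatWeight]
    field_simp
  have h0 : Filter.Tendsto (fun r : ℝ => 2 / a ^ 2 * Real.exp (-(a ^ 2 / (2 * r))))
      (nhdsWithin 0 (Set.Ioi 0)) (nhds (2 / a ^ 2 * 0)) := by
    refine Filter.Tendsto.const_mul _ (Real.tendsto_exp_neg_atTop_nhds_zero.comp ?_)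
    have : (fun r : ℝ => a ^ 2 / (2 * r)) = fun r => a ^ 2 / 2 * r⁻¹ := by
      ext r; rw [div_mul_eq_div_div, div_eq_mul_inv]
    rw [this]
    exact tendsto_inv_nhdsGT_zero.const_mul_atTop (by positivity)
  have := intervalIntegral.integral_eq_sub_of_hasDerivAt_of_tendsto hT
    (fun r hr => hd r hr.1) (intervalIntegrable_heatWeight 2 ha hT) h0
    ((hd T hT).continuousAt.tendsto.mono_left nhdsWithin_le_nhds)
  simpa using this

lemma heatVolterra_two_le (j : ℕ) {T lam a : ℝ} (hT : 0 < T) (hlam : 0 < lam) (ha : 0 < a) :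
    heatVolterra 2 j T lam a
      ≤ 2 / a ^ 2 * Real.exp (-(a ^ 2 / (2 * T))) * volterraMoment j (T * lam) := by
  rw [← integral_heatWeight_two hT ha, ← intervalIntegral.integral_mul_const]
  refine intervalIntegral.integral_mono_on_of_le_Ioo hT.le
    (intervalIntegrable_heatVolterra 2 j hT hlam ha)
    ((intervalIntegrable_heatWeight 2 ha hT).mul_const _) fun r hr => ?_
  have := (volterraMoment_comp_mem j hlam (Set.Ioo_subset_Ioc_self hr)).2
  have := heatWeight_pos 2 a hr.1
  gcongr

lemma volterraMoment_cross_le {T lam u v : ℝ} (hlam : 0 < lam)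
    (hu : u ∈ Set.Ioo 0 T) (hv : v ∈ Set.Ioo 0 T) :
    volterraMoment 1 ((T - u) * lam) * volterraMoment 0 ((T - v) * lam)
        - volterraMoment 0 ((T - u) * lam) * volterraMoment 1 ((T - v) * lam)
      ≤ volterraMoment 0 ((T - u) * lam) *
        (v / T * (volterraMoment 1 (T * lam) + volterraMoment 2 (T * lam))) := by
  have hT : 0 < T := hu.1.trans hu.2
  have hu' : 0 < (T - u) * lam := mul_pos (by linarith [hu.2]) hlam
  have hv' : 0 < (T - v) * lam := mul_pos (by linarith [hv.2]) hlam
  have h0u := volterraMoment_pos 0 hu'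
  have h1u := volterraMoment_pos 1 hu'
  have h1 := volterraMoment_pos 1 (mul_pos hT hlam)
  have h2 := volterraMoment_pos 2 (mul_pos hT hlam)
  have hv0 := hv.1
  rcases le_total u v with huv | huv
  · have hle : (T - v) * lam ≤ (T - u) * lam := by gcongr
    have hmono := monotoneOn_volterraMoment 0 hv'.le hu'.le hle
    have hsub := volterraMoment_sub_le (mul_pos hT hlam) (θ := v / T) (by positivity)
      ((div_lt_one hT).mpr hv.2)
    rw [show (1 - v / T) * (T * lam) = (T - v) * lam by field_simp] at hsub
    have hD := (volterraMoment_comp_mem 1 hlam (Set.Ioo_subset_Ioc_self hu)).2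
    nlinarith [mul_le_mul_of_nonneg_left hmono h1u.le]
  · have hle : (T - u) * lam ≤ (T - v) * lam := by gcongr
    have := volterraMoment_mul_le hu' hle
    have h3 : 0 ≤ volterraMoment 0 ((T - u) * lam) *
        (v / T * (volterraMoment 1 (T * lam) + volterraMoment 2 (T * lam))) := by positivity
    linarith

lemma heatVolterra_cross_le {T lam a : ℝ} (hT : 0 < T) (hlam : 0 < lam) (ha : 0 < a) :
    heatVolterra 2 1 T lam a * heatVolterra 1 0 T lam a
        - heatVolterra 2 0 T lam a * heatVolterra 1 1 T lam a
      ≤ heatVolterra 2 0 T lam a *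
        (volterraMoment 1 (T * lam) + volterraMoment 2 (T * lam)) := by
  set E := volterraMoment 1 (T * lam) + volterraMoment 2 (T * lam) with hE
  have hTl := mul_pos hT hlam
  have hE0 : 0 < E := add_pos (volterraMoment_pos 1 hTl) (volterraMoment_pos 2 hTl)
  have hi := fun n j => intervalIntegrable_heatVolterra n j hT hlam ha
  have hinner : ∀ u ∈ Set.Ioo 0 T,
      volterraMoment 1 ((T - u) * lam) * heatVolterra 1 0 T lam a
        - volterraMoment 0 ((T - u) * lam) * heatVolterra 1 1 T lam a
      ≤ volterraMoment 0 ((T - u) * lam) * E := by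
    intro u hu
    have h0u := volterraMoment_pos 0 (mul_pos (by linarith [hu.2] : 0 < T - u) hlam)
    calc _ = ∫ v in (0 : ℝ)..T,
          (volterraMoment 1 ((T - u) * lam) *
              (heatWeight 1 a v * volterraMoment 0 ((T - v) * lam))
            - volterraMoment 0 ((T - u) * lam) *
              (heatWeight 1 a v * volterraMoment 1 ((T - v) * lam))) := by
          rw [intervalIntegral.integral_sub ((hi 1 0).const_mul _) ((hi 1 1).const_mul _),
            intervalIntegral.integral_const_mul, intervalIntegral.integral_const_mul]
          rfl
      _ ≤ ∫ _ in (0 : ℝ)..T, volterraMoment 0 ((T - u) * lam) * (E / T) := by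
          refine intervalIntegral.integral_mono_on_of_le_Ioo hT.le
            (((hi 1 0).const_mul _).sub ((hi 1 1).const_mul _)) intervalIntegrable_const
            fun v hv => ?_
          have hv0 := hv.1
          have hw := heatWeight_pos 1 a hv0
          have hwv : heatWeight 1 a v * v ≤ 1 := by
            rw [heatWeight, pow_one, div_mul_cancel₀ _ hv0.ne', Real.exp_le_one_iff]
            have : 0 ≤ a ^ 2 / (2 * v) := by positivity
            linarith
          have hc := mul_le_mul_of_nonneg_left (volterraMoment_cross_le hlam hu hv) hw.le
          calc _ = heatWeight 1 a v * (volterraMoment 1 ((T - u) * lam) *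
                volterraMoment 0 ((T - v) * lam) - volterraMoment 0 ((T - u) * lam) *
                volterraMoment 1 ((T - v) * lam)) := by ring
            _ ≤ _ := hc
            _ = (heatWeight 1 a v * v) * (volterraMoment 0 ((T - u) * lam) * (E / T)) := by
              rw [← hE]; ring
            _ ≤ _ := mul_le_of_le_one_left (by positivity) hwv
      _ = _ := by
          rw [intervalIntegral.integral_const, smul_eq_mul]
          field_simp
          ring
  calc _ = ∫ u in (0 : ℝ)..T,
        (heatWeight 2 a u * volterraMoment 1 ((T - u) * lam) * heatVolterra 1 0 T lam a
          - heatWeight 2 a u * volterraMoment 0 ((T - u) * lam) * heatVolterra 1 1 T lam a) := by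
        rw [intervalIntegral.integral_sub ((hi 2 1).mul_const _) ((hi 2 0).mul_const _),
          intervalIntegral.integral_mul_const, intervalIntegral.integral_mul_const]
        rfl
    _ ≤ ∫ u in (0 : ℝ)..T, heatWeight 2 a u * volterraMoment 0 ((T - u) * lam) * E := by
        refine intervalIntegral.integral_mono_on_of_le_Ioo hT.le
          (((hi 2 1).mul_const _).sub ((hi 2 0).mul_const _)) ((hi 2 0).mul_const _)
          fun u hu => ?_
        have := mul_le_mul_of_nonneg_left (hinner u hu) (heatWeight_pos 2 a hu.1).le
        linarith
    _ = _ := by rw [intervalIntegral.integral_mul_const]; rfl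

lemma heatWeight_two_eq (a r : ℝ) : heatWeight 2 a r = r⁻¹ * heatWeight 1 a r := by
  rw [heatWeight, heatWeight, pow_one, pow_two r, ← div_div, div_eq_inv_mul _ r]

lemma heatVolterra_cross_nonneg {T lam a : ℝ} (hT : 0 < T) (hlam : 0 < lam) (ha : 0 < a) :
    heatVolterra 2 0 T lam a * heatVolterra 1 1 T lam a
      ≤ heatVolterra 2 1 T lam a * heatVolterra 1 0 T lam a := by
  have hi := fun n j => intervalIntegrable_heatVolterra n j hT hlam ha
  have h10 := heatVolterra_pos 1 0 hT hlam ha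
  set m := heatVolterra 2 0 T lam a / heatVolterra 1 0 T lam a with hm
  have hmT : 1 / T < m := by
    have h : 0 < ∫ r in (0 : ℝ)..T, (heatWeight 2 a r * volterraMoment 0 ((T - r) * lam)
        - 1 / T * (heatWeight 1 a r * volterraMoment 0 ((T - r) * lam))) := by
      refine intervalIntegral.intervalIntegral_pos_of_pos_on
        ((hi 2 0).sub ((hi 1 0).const_mul _)) (fun r hr => ?_) hT
      have hr0 := hr.1
      have hV := volterraMoment_pos 0 (mul_pos (by linarith [hr.2] : 0 < T - r) hlam)
      have hw := heatWeight_pos 1 a hr0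
      have h1 : 0 < r⁻¹ - 1 / T := by
        rw [one_div, sub_pos]
        exact inv_strictAnti₀ hr0 hr.2
      rw [heatWeight_two_eq]
      calc 0 < (r⁻¹ - 1 / T) * (heatWeight 1 a r * volterraMoment 0 ((T - r) * lam)) := by
            positivity
        _ = _ := by ring
    rw [intervalIntegral.integral_sub (hi 2 0) ((hi 1 0).const_mul _),
      intervalIntegral.integral_const_mul] at h
    rw [hm, lt_div_iff₀ h10]
    exact sub_pos.mp h
  have hm0 : 0 < m := lt_trans (by positivity) hmT
  set ρ := m⁻¹ with hρ
  have hρ0 : 0 < ρ := inv_pos.mpr hm0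
  have hρT : ρ < T := by
    rw [one_div] at hmT
    exact inv_lt_of_inv_lt₀ hT hmT
  have hρ' : 0 < (T - ρ) * lam := mul_pos (by linarith) hlam
  have hV0 := volterraMoment_pos 0 hρ'
  set q := volterraMoment 1 ((T - ρ) * lam) / volterraMoment 0 ((T - ρ) * lam) with hq
  have hle : q * (heatVolterra 2 0 T lam a - m * heatVolterra 1 0 T lam a)
      ≤ heatVolterra 2 1 T lam a - m * heatVolterra 1 1 T lam a := by
    unfold heatVolterra
    rw [← intervalIntegral.integral_const_mul, ← intervalIntegral.integral_const_mul,
      ← intervalIntegral.integral_sub (hi 2 0) ((hi 1 0).const_mul _),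
      ← intervalIntegral.integral_sub (hi 2 1) ((hi 1 1).const_mul _),
      ← intervalIntegral.integral_const_mul]
    refine intervalIntegral.integral_mono_on_of_le_Ioo hT.le
      (((hi 2 0).sub ((hi 1 0).const_mul _)).const_mul _)
      ((hi 2 1).sub ((hi 1 1).const_mul _)) fun r hr => ?_
    have hr0 := hr.1
    have hr' : 0 < (T - r) * lam := mul_pos (by linarith [hr.2]) hlam
    have hw := heatWeight_pos 1 a hr0
    have hkey : (r⁻¹ - m) * (q * volterraMoment 0 ((T - r) * lam))
        ≤ (r⁻¹ - m) * volterraMoment 1 ((T - r) * lam) := by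
      rw [hq, div_mul_eq_mul_div]
      rcases le_total r ρ with h | h
      · have h1 : m ≤ r⁻¹ := by rw [← inv_inv m]; exact inv_anti₀ hr0 h
        refine mul_le_mul_of_nonneg_left ?_ (by linarith)
        rw [div_le_iff₀ hV0]
        have := volterraMoment_mul_le hρ' (show (T - ρ) * lam ≤ (T - r) * lam by gcongr)
        linarith
      · have h1 : r⁻¹ ≤ m := by rw [← inv_inv m]; exact inv_anti₀ hρ0 h
        refine mul_le_mul_of_nonpos_left ?_ (by linarith)
        rw [le_div_iff₀ hV0]
        have := volterraMoment_mul_le hr' (show (T - r) * lam ≤ (T - ρ) * lam by gcongr)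
        linarith
    rw [heatWeight_two_eq]
    calc _ = heatWeight 1 a r * ((r⁻¹ - m) * (q * volterraMoment 0 ((T - r) * lam))) := by ring
      _ ≤ heatWeight 1 a r * ((r⁻¹ - m) * volterraMoment 1 ((T - r) * lam)) := by gcongr
      _ = _ := by ring
  have h20 : heatVolterra 2 0 T lam a = m * heatVolterra 1 0 T lam a := by
    rw [hm]; field_simp
  rw [h20, sub_self, mul_zero] at hle
  rw [h20]
  nlinarith

lemma le_one_add_heatVolterra {T lam a : ℝ} (hT : 0 < T) (hlam : 0 < lam) (ha : 0 < a) :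
    1 / (2 * Real.exp 1 ^ 2) * (1 + logPlus (2 * T / a ^ 2))
      ≤ (1 + logPlus (1 / (T * lam))) * (1 + heatVolterra 1 0 T lam a) := by
  have he : 2 < Real.exp 1 := by linarith [Real.exp_one_gt_d9]
  set c := 1 / (2 * Real.exp 1 ^ 2) with hc
  have hc0 : 0 < c := by positivity
  have hc1 : c ≤ 1 / 8 := by
    rw [hc]
    refine one_div_le_one_div_of_le (by norm_num) ?_
    nlinarith
  have hlog2 : Real.log 2 < 1 := by linarith [Real.log_two_lt_d9]
  have hlog20 : 0 < Real.log 2 := Real.log_pos (by norm_num)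
  have hh := heatVolterra_pos 1 0 hT hlam ha
  set m := 1 + logPlus (1 / (T * lam)) with hm
  have hm1 : 1 ≤ m := by linarith [logPlus_nonneg (1 / (T * lam))]
  have hlogT : Real.log (2 * T / a ^ 2) = Real.log (T / a ^ 2) + Real.log 2 := by
    rw [mul_div_assoc, Real.log_mul (by norm_num) (by positivity)]; ring
  rcases le_total T (a ^ 2) with hTa | hTa
  · have h1 : logPlus (2 * T / a ^ 2) ≤ 1 := by
      refine max_le ?_ zero_le_one
      have : Real.log (T / a ^ 2) ≤ 0 :=
        Real.log_nonpos (by positivity) ((div_le_one (by positivity)).mpr hTa)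
      linarith
    nlinarith [logPlus_nonneg (2 * T / a ^ 2)]
  · have hlog0 : 0 ≤ Real.log (T / a ^ 2) :=
      Real.log_nonneg ((one_le_div (by positivity)).mpr hTa)
    have hlp : logPlus (2 * T / a ^ 2) = Real.log (T / a ^ 2) + Real.log 2 := by
      rw [logPlus, hlogT, max_eq_left (by linarith)]
    have hV := volterraMoment_pos 0 (by positivity : 0 < T * lam / 2)
    have hlow : Real.exp (-1) * volterraMoment 0 (T * lam / 2) * Real.log (T / a ^ 2)
        ≤ heatVolterra 1 0 T lam a := by
      have hA : 0 < a ^ 2 / 2 := by positivity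
      have hsubset : Set.uIcc (a ^ 2 / 2) (T / 2) ⊆ Set.uIcc 0 T := by
        rw [Set.uIcc_of_le (by linarith), Set.uIcc_of_le hT.le]
        exact Set.Icc_subset_Icc hA.le (by linarith)
      have hi := intervalIntegrable_heatVolterra 1 0 hT hlam ha
      calc _ = ∫ r in (a ^ 2 / 2)..(T / 2),
            Real.exp (-1) * volterraMoment 0 (T * lam / 2) * r⁻¹ := by
            rw [intervalIntegral.integral_const_mul, integral_inv_of_pos hA (by positivity)]
            congr 2
            field_simp
        _ ≤ ∫ r in (a ^ 2 / 2)..(T / 2),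
            heatWeight 1 a r * volterraMoment 0 ((T - r) * lam) := by
            refine intervalIntegral.integral_mono_on (by linarith) ?_ (hi.mono_set hsubset)
              fun r hr => ?_
            · refine (intervalIntegral.intervalIntegrable_inv (fun r hr => ?_)
                continuousOn_id).const_mul _
              rw [Set.uIcc_of_le (by linarith)] at hr
              exact (hA.trans_le hr.1).ne'
            · have hr0 : 0 < r := hA.trans_le hr.1
              have hv : volterraMoment 0 (T * lam / 2) ≤ volterraMoment 0 ((T - r) * lam) := by
                have hle : T * lam / 2 ≤ (T - r) * lam := by nlinarith [hr.2]
                have h0 : 0 ≤ T * lam / 2 := by positivity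
                exact monotoneOn_volterraMoment 0 h0 (h0.trans hle) hle
              have hw : Real.exp (-1) * r⁻¹ ≤ heatWeight 1 a r := by
                rw [heatWeight, pow_one, div_eq_mul_inv]
                have : a ^ 2 / (2 * r) ≤ 1 := by
                  rw [div_le_one (by positivity)]; linarith [hr.1]
                gcongr
              calc _ = Real.exp (-1) * r⁻¹ * volterraMoment 0 (T * lam / 2) := by ring
                _ ≤ _ := by
                  have := heatWeight_pos 1 a hr0
                  gcongr
        _ ≤ _ := by
            refine intervalIntegral.integral_mono_interval hA.le (by linarith) (by linarith) ?_ hi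
            filter_upwards [ae_restrict_mem measurableSet_Ioc] with r hr
            exact mul_nonneg (heatWeight_pos 1 a hr.1).le
              (volterraMoment_comp_mem 0 hlam hr).1
    have hmV := le_volterraMoment_zero_half (mul_pos hT hlam)
    rw [← hm] at hmV
    have hcV : c ≤ Real.exp (-1) * (m * volterraMoment 0 (T * lam / 2)) := by
      calc c = Real.exp (-1) * (1 / (2 * Real.exp 1)) := by
            rw [hc, Real.exp_neg]; field_simp
        _ ≤ _ := by gcongr
    have hfin : c * Real.log (T / a ^ 2) ≤ m * heatVolterra 1 0 T lam a := by
      calc _ ≤ Real.exp (-1) * (m * volterraMoment 0 (T * lam / 2)) * Real.log (T / a ^ 2) := by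
            gcongr
        _ = m * (Real.exp (-1) * volterraMoment 0 (T * lam / 2) * Real.log (T / a ^ 2)) := by
            ring
        _ ≤ _ := by gcongr
    rw [hlp]
    nlinarith

lemma deriv_bbar_pos {T lam a : ℝ} (hT : 0 < T) (hlam : 0 < lam) (ha : 0 < a) :
    0 < deriv (fun l => bbar T l a) lam := by
  rw [(hasDerivAt_bbar hT hlam ha).deriv]
  have h1 := heatVolterra_cross_nonneg hT hlam ha
  have h2 := heatVolterra_pos 2 1 hT hlam ha
  have h3 := heatVolterra_pos 1 0 hT hlam ha
  have h4 : 0 < heatVolterra 2 1 T lam a * (1 + heatVolterra 1 0 T lam a)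
        - heatVolterra 2 0 T lam a * heatVolterra 1 1 T lam a := by linarith
  positivity

lemma mul_deriv_bbar {T lam a : ℝ} (hT : 0 < T) (hlam : 0 < lam) (ha : 0 < a) :
    lam * deriv (fun l => bbar T l a) lam =
      a * (heatVolterra 2 1 T lam a * (1 + heatVolterra 1 0 T lam a)
        - heatVolterra 2 0 T lam a * heatVolterra 1 1 T lam a)
        / (1 + heatVolterra 1 0 T lam a) ^ 2 := by
  rw [(hasDerivAt_bbar hT hlam ha).deriv]
  field_simp

lemma mul_deriv_bbar_le {T lam a : ℝ} (hT : 0 < T) (hlam : 0 < lam) (ha : 0 < a) :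
    lam * deriv (fun l => bbar T l a) lam ≤
      2 / a * volterraMoment 1 (T * lam) * Real.exp (-(a ^ 2 / (2 * T))) := by
  rw [mul_deriv_bbar hT hlam ha]
  have h20 := heatVolterra_pos 2 0 hT hlam ha
  have h11 := heatVolterra_pos 1 1 hT hlam ha
  have h21 := heatVolterra_pos 2 1 hT hlam ha
  have h10 := heatVolterra_pos 1 0 hT hlam ha
  have hle := heatVolterra_two_le 1 hT hlam ha
  calc _ ≤ a * heatVolterra 2 1 T lam a := by
        rw [div_le_iff₀ (by positivity), mul_assoc]
        refine mul_le_mul_of_nonneg_left ?_ ha.le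
        nlinarith [mul_pos h20 h11, mul_pos h21 h10, mul_pos (mul_pos h21 h10) h10]
    _ ≤ a * (2 / a ^ 2 * Real.exp (-(a ^ 2 / (2 * T))) * volterraMoment 1 (T * lam)) := by gcongr
    _ = _ := by field_simp

lemma mul_deriv_bbar_le_div_sq {T lam a : ℝ} (hT : 0 < T) (hlam : 0 < lam) (ha : 0 < a) :
    lam * deriv (fun l => bbar T l a) lam ≤
      2 / a * (volterraMoment 1 (T * lam) + volterraMoment 0 (T * lam) *
        (volterraMoment 1 (T * lam) + volterraMoment 2 (T * lam)))
        / (1 + heatVolterra 1 0 T lam a) ^ 2 := by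
  rw [mul_deriv_bbar hT hlam ha]
  have hTl := mul_pos hT hlam
  have hV := fun j => volterraMoment_pos j hTl
  have hexp : Real.exp (-(a ^ 2 / (2 * T))) ≤ 1 := by
    rw [Real.exp_le_one_iff, neg_nonpos]; positivity
  have hle : ∀ j, heatVolterra 2 j T lam a ≤ 2 / a ^ 2 * volterraMoment j (T * lam) := by
    intro j
    have := hV j
    refine (heatVolterra_two_le j hT hlam ha).trans ?_
    gcongr
    exact mul_le_of_le_one_right (by positivity) hexp
  have hcross := heatVolterra_cross_le hT hlam ha
  set E := volterraMoment 1 (T * lam) + volterraMoment 2 (T * lam) with hE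
  have hE0 : 0 < E := add_pos (hV 1) (hV 2)
  have := heatVolterra_pos 1 0 hT hlam ha
  refine div_le_div_of_nonneg_right ?_ (by positivity)
  calc _ ≤ a * (2 / a ^ 2 * volterraMoment 1 (T * lam)
          + 2 / a ^ 2 * volterraMoment 0 (T * lam) * E) := by
        refine mul_le_mul_of_nonneg_left ?_ ha.le
        have := mul_le_mul_of_nonneg_right (hle 0) hE0.le
        linarith [hle 1]
    _ = _ := by field_simp

/-- For fixed `T, a > 0` the drift magnitude `λ ↦ b̄_T^λ(a)` is strictly increasing on `(0,∞)`
(equivalently, its partial derivative in `λ` is strictly positive for all `T, a, λ > 0`).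
Moreover, for every `L > 1` there is `C_L > 0` such that for all `T, a, λ > 0` with `Tλ ≤ L`:
`λ (∂/∂λ) b̄_T^λ(a) ≤ (C_L/a) (e^{−a²/(2T)}/(1+log⁺(1/(Tλ)))²)` when `a² ≥ 2T²λ`, and
`λ (∂/∂λ) b̄_T^λ(a) ≤ (C_L/a) (1/(1+log⁺(2T/a²))²)` when `a² < 2T²λ`. -/
theorem bbar_strictMono_and_lambdaDeriv_bound :
    (∀ T a : ℝ, 0 < T → 0 < a → StrictMonoOn (fun lam => bbar T lam a) (Set.Ioi 0)) ∧
    (∀ T a lam : ℝ, 0 < T → 0 < a → 0 < lam →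
      0 < deriv (fun lam' => bbar T lam' a) lam) ∧
    (∀ L : ℝ, 1 < L → ∃ C > 0, ∀ T a lam : ℝ, 0 < T → 0 < a → 0 < lam → T * lam ≤ L →
      lam * deriv (fun lam' => bbar T lam' a) lam ≤ (C / a) *
        (if 2 * T ^ 2 * lam ≤ a ^ 2 then
          Real.exp (-(a ^ 2 / (2 * T))) / (1 + logPlus (1 / (T * lam))) ^ 2
        else 1 / (1 + logPlus (2 * T / a ^ 2)) ^ 2)) := by
  refine ⟨fun T a hT ha => ?_, fun T a lam hT ha hlam => deriv_bbar_pos hT hlam ha,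
    fun L hL => ?_⟩
  · refine strictMonoOn_of_deriv_pos (convex_Ioi 0)
      (fun l hl => (hasDerivAt_bbar hT hl ha).continuousAt.continuousWithinAt) fun l hl => ?_
    rw [interior_Ioi] at hl
    exact deriv_bbar_pos hT hl ha
  · set M := Real.exp (L * Real.exp 1) with hM
    have hM0 : 0 < M := Real.exp_pos _
    set c := 1 / (2 * Real.exp 1 ^ 2) with hc
    have hc0 : 0 < c := by positivity
    refine ⟨2 * M + 2 * (M + 3 * M ^ 2) / c ^ 2, by positivity,
      fun T a lam hT ha hlam hTL => ?_⟩
    have hTl := mul_pos hT hlam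
    have hm1 : 1 ≤ 1 + logPlus (1 / (T * lam)) := by linarith [logPlus_nonneg (1 / (T * lam))]
    have hV0 := volterraMoment_le 0 hTl hTL hL.le
    have hV1 := volterraMoment_le 1 hTl hTL hL.le
    have hV2 := volterraMoment_le 2 hTl hTL hL.le
    have hlow := le_one_add_heatVolterra hT hlam ha
    have hb1 := mul_deriv_bbar_le hT hlam ha
    have hb2 := mul_deriv_bbar_le_div_sq hT hlam ha
    rw [← hM] at hV0 hV1 hV2
    rw [← hc] at hlow
    set m := 1 + logPlus (1 / (T * lam)) with hm
    have hm0 : 0 < m := by linarith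
    have hp0 := volterraMoment_pos 0 hTl
    have hp1 := volterraMoment_pos 1 hTl
    have hp2 := volterraMoment_pos 2 hTl
    replace hV0 : volterraMoment 0 (T * lam) ≤ M := by
      refine hV0.trans (mul_le_of_le_one_right hM0.le ?_)
      simpa using inv_le_one_of_one_le₀ hm1
    replace hV1 : volterraMoment 1 (T * lam) ≤ M / m ^ 2 := by
      simpa [div_eq_mul_inv] using hV1
    replace hV2 : volterraMoment 2 (T * lam) ≤ 2 * M / m ^ 2 := by
      refine hV2.trans ?_
      rw [mul_div_assoc', mul_comm M]
      simp only [Nat.factorial_two, Nat.cast_ofNat]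
      have : m ^ 2 ≤ m ^ (2 + 1) := pow_le_pow_right₀ hm1 (by norm_num)
      gcongr
    split_ifs with hcase
    · calc _ ≤ 2 / a * (M / m ^ 2) * Real.exp (-(a ^ 2 / (2 * T))) := hb1.trans (by gcongr)
        _ = (2 * M) / a * (Real.exp (-(a ^ 2 / (2 * T))) / m ^ 2) := by ring
        _ ≤ _ := by
          gcongr
          exact le_add_of_nonneg_right (by positivity)
    · have hl0 := logPlus_nonneg (2 * T / a ^ 2)
      set ℓ := 1 + logPlus (2 * T / a ^ 2) with hℓ
      have hℓ0 : 0 < ℓ := by linarith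
      set h := 1 + heatVolterra 1 0 T lam a with hh
      have hh0 : 0 < h := by linarith [heatVolterra_pos 1 0 hT hlam ha]
      calc _ ≤ 2 / a * (M / m ^ 2 + M * (M / m ^ 2 + 2 * M / m ^ 2)) / h ^ 2 :=
            hb2.trans (by gcongr)
        _ = 2 * (M + 3 * M ^ 2) / a * (1 / (m * h) ^ 2) := by field_simp; ring
        _ ≤ 2 * (M + 3 * M ^ 2) / a * (1 / (c * ℓ) ^ 2) := by gcongr
        _ = 2 * (M + 3 * M ^ 2) / c ^ 2 / a * (1 / ℓ ^ 2) := by field_simp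
        _ ≤ _ := by
          gcongr
          exact le_add_of_nonneg_left (by positivity)
end

section
/- For every L > 0 there exists a constant C_L > 0 such that for all nonzero x, y ∈ ℝ² and all t, λ > 0 with tλ ≤ L, one has h_t^λ(x,y) ≤ (C_L / t) · (1 / (1 + log⁺(1/(λt)))) · (e^{−|x|²/(2t)} + log⁺(2t/|x|²)) · (e^{−|y|²/(2t)} + log⁺(2t/|y|²)). -/
open MeasureTheory Real

/-- The derivative of the Volterra function: `ν′(x) = ∫₀^∞ s x^{s−1} / Γ(s+1) ds` for `x > 0`. -/
noncomputable def volterraDeriv (x : ℝ) : ℝ :=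
  ∫ s in Set.Ioi (0 : ℝ), s * x ^ (s - 1) / Real.Gamma (s + 1)

/-- The two-dimensional Gaussian density `g_t(x) = (1/(2πt)) e^{−|x|²/(2t)}`. -/
noncomputable def gauss2 (t : ℝ) (x : EuclideanSpace ℝ (Fin 2)) : ℝ :=
  (1 / (2 * Real.pi * t)) * Real.exp (-(‖x‖ ^ 2 / (2 * t)))

/-- The kernel `h_t^λ(x,y) = 2πλ ∫∫_{0<r<s<t} g_r(x) ν′((s−r)λ) g_{t−s}(y) ds dr`. -/
noncomputable def hKer (t lam : ℝ) (x y : EuclideanSpace ℝ (Fin 2)) : ℝ :=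
  2 * Real.pi * lam *
    ∫ r in Set.Ioo (0 : ℝ) t, ∫ s in Set.Ioo r t,
      gauss2 r x * volterraDeriv ((s - r) * lam) * gauss2 (t - s) y

/-- The integral defining `volterraDeriv`, taken in `[0, ∞]`. -/
noncomputable def volterraDerivENN (u : ℝ) : ENNReal :=
  ∫⁻ s in Set.Ioi (0 : ℝ), ENNReal.ofReal (s * u ^ (s - 1) / Real.Gamma (s + 1))

lemma rpow_le_exp_mul_Gamma {Q s : ℝ} (hQ : 0 < Q) (hs : 0 ≤ s) :
    Q ^ s ≤ exp Q * Gamma (s + 1) := by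
  have hint := Real.GammaIntegral_convergent (s := s + 1) (by linarith)
  have hsub : Set.Ioi Q ⊆ Set.Ioi (0 : ℝ) := Set.Ioi_subset_Ioi hQ.le
  have hlow : exp (-Q) * Q ^ s ≤ Gamma (s + 1) := by
    rw [Real.Gamma_eq_integral (by linarith), ← integral_exp_neg_Ioi, ← integral_mul_const]
    refine le_trans ?_ (setIntegral_mono_set hint ?_ hsub.eventuallyLE)
    · refine setIntegral_mono_on ?_ (hint.mono_set hsub) measurableSet_Ioi fun x hx => ?_
      · have := integrableOn_exp_mul_Ioi (a := -1) (by norm_num) Q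
        simp only [neg_one_mul] at this
        exact this.mul_const _
      · rw [add_sub_cancel_right]
        have : Q ^ s ≤ x ^ s := rpow_le_rpow hQ.le (le_of_lt hx) hs
        gcongr
    · filter_upwards [ae_restrict_mem measurableSet_Ioi] with x hx
      have : (0 : ℝ) < x := hx
      simp only [Pi.zero_apply]
      positivity
  calc Q ^ s = exp Q * (exp (-Q) * Q ^ s) := by
        rw [← mul_assoc, ← exp_add, add_neg_cancel, exp_zero, one_mul]
    _ ≤ _ := by gcongr

lemma one_add_mul_rpow_div_Gamma_le {M u s : ℝ} (hM : 1 ≤ M) (hu : 0 < u) (huM : u ≤ M)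
    (hs : 0 ≤ s) :
    (1 + s) * u ^ s / Gamma (s + 1) ≤
      exp (exp 2 * M) * exp (-(1 + logPlus (1 / u)) * s) := by
  have hΓ : 0 < Gamma (s + 1) := Gamma_pos_of_pos (by linarith)
  have hM0 : 0 < M := by linarith
  have hlog : log u + logPlus (1 / u) ≤ log M := by
    have h1 : 0 ≤ log M := log_nonneg hM
    have h2 : log u ≤ log M := log_le_log hu huM
    rw [logPlus, one_div, log_inv]
    rcases max_choice (-log u) 0 with h | h <;> rw [h] <;> linarith
  rw [div_le_iff₀ hΓ]
  have hQ := rpow_le_exp_mul_Gamma (Q := exp 2 * M) (by positivity) hs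
  rw [rpow_def_of_pos (by positivity), log_mul (by positivity) (by positivity), log_exp] at hQ
  calc (1 + s) * u ^ s ≤ exp s * exp (log u * s) := by
        rw [rpow_def_of_pos hu]
        gcongr
        linarith [add_one_le_exp s]
    _ ≤ exp ((2 + log M) * s) * exp (-(1 + logPlus (1 / u)) * s) := by
        rw [← exp_add, ← exp_add, exp_le_exp]
        nlinarith
    _ ≤ exp (exp 2 * M) * Gamma (s + 1) * exp (-(1 + logPlus (1 / u)) * s) := by gcongr
    _ = _ := by ring

lemma lintegral_one_add_mul_rpow_div_Gamma_le {M u : ℝ} (hM : 1 ≤ M) (hu : 0 < u)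
    (huM : u ≤ M) :
    ∫⁻ s in Set.Ioi (0 : ℝ), ENNReal.ofReal ((1 + s) * u ^ s / Gamma (s + 1)) ≤
      ENNReal.ofReal (exp (exp 2 * M) / (1 + logPlus (1 / u))) := by
  have hℓ := logPlus_nonneg (1 / u)
  have hneg : -(1 + logPlus (1 / u)) < 0 := by linarith
  calc _ ≤ ∫⁻ s in Set.Ioi (0 : ℝ),
        ENNReal.ofReal (exp (exp 2 * M) * exp (-(1 + logPlus (1 / u)) * s)) := by
        refine setLIntegral_mono' measurableSet_Ioi fun s hs => ?_
        exact ENNReal.ofReal_le_ofReal (one_add_mul_rpow_div_Gamma_le hM hu huM (le_of_lt hs))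
    _ = _ := by
        rw [← ofReal_integral_eq_lintegral_ofReal, integral_const_mul, integral_exp_mul_Ioi hneg]
        · congr 1
          simp only [mul_zero, exp_zero]
          field_simp
        · exact (integrableOn_exp_mul_Ioi hneg 0).const_mul _
        · exact Filter.Eventually.of_forall fun s => by positivity

lemma enorm_volterraDeriv_le {u : ℝ} (hu : 0 < u) :
    ‖volterraDeriv u‖ₑ ≤ volterraDerivENN u := by
  refine (enorm_integral_le_lintegral_enorm _).trans
    (setLIntegral_mono' measurableSet_Ioi fun s hs => ?_)
  have hs' : (0 : ℝ) < s := hs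
  have hΓ : 0 < Gamma (s + 1) := Gamma_pos_of_pos (by linarith)
  rw [Real.enorm_of_nonneg (by positivity)]

lemma measurable_inv_Gamma : Measurable fun s : ℝ => (Gamma s)⁻¹ := by
  have h : Continuous fun s : ℝ => ((Complex.Gamma (s : ℂ))⁻¹).re :=
    Complex.continuous_re.comp
      (Complex.differentiable_one_div_Gamma.continuous.comp Complex.continuous_ofReal)
  convert h.measurable using 2 with s
  rw [Complex.Gamma_ofReal, ← Complex.ofReal_inv, Complex.ofReal_re]

lemma measurable_volterraDeriv_integrand :
    Measurable fun p : ℝ × ℝ =>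
      ENNReal.ofReal (p.2 * p.1 ^ (p.2 - 1) / Gamma (p.2 + 1)) := by
  simp only [div_eq_mul_inv]
  have h := measurable_inv_Gamma.comp (f := fun p : ℝ × ℝ => p.2 + 1) (by fun_prop)
  refine ENNReal.measurable_ofReal.comp (Measurable.mul ?_ h)
  exact measurable_snd.mul (measurable_fst.pow (measurable_snd.sub_const 1))

lemma measurable_volterraDerivENN : Measurable volterraDerivENN :=
  measurable_volterraDeriv_integrand.lintegral_prod_right'

lemma volterraDerivENN_le {M u : ℝ} (hM : 1 ≤ M) (hu : 0 < u) (huM : u ≤ M) :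
    volterraDerivENN u ≤ ENNReal.ofReal (exp (exp 2 * M) / (1 + logPlus (1 / u)) / u) := by
  have hconst : volterraDerivENN u = ∫⁻ s in Set.Ioi (0 : ℝ),
      ENNReal.ofReal (s * u ^ s / Gamma (s + 1)) * ENNReal.ofReal u⁻¹ := by
    refine setLIntegral_congr_fun measurableSet_Ioi fun s hs => ?_
    have hs' : (0 : ℝ) < s := hs
    have hΓ : 0 < Gamma (s + 1) := Gamma_pos_of_pos (by linarith)
    rw [← ENNReal.ofReal_mul (by positivity), rpow_sub_one hu.ne']
    congr 1
    ring
  rw [hconst, lintegral_mul_const' _ _ ENNReal.ofReal_ne_top, div_eq_mul_inv _ u,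
    ENNReal.ofReal_mul (by have := logPlus_nonneg (1 / u); positivity)]
  gcongr
  refine le_trans (setLIntegral_mono' measurableSet_Ioi fun s hs => ?_)
    (lintegral_one_add_mul_rpow_div_Gamma_le hM hu huM)
  have hs' : (0 : ℝ) < s := hs
  have hΓ : 0 < Gamma (s + 1) := Gamma_pos_of_pos (by linarith)
  gcongr
  linarith

lemma lintegral_mul_rpow_sub_one {s t lam : ℝ} (hs : 0 < s) (ht : 0 < t) (hlam : 0 < lam) :
    ∫⁻ c in Set.Ioo 0 t, ENNReal.ofReal (s * (c * lam) ^ (s - 1) / Gamma (s + 1)) =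
      ENNReal.ofReal ((t * lam) ^ s / Gamma (s + 1)) * ENNReal.ofReal lam⁻¹ := by
  have hΓ : 0 < Gamma (s + 1) := Gamma_pos_of_pos (by linarith)
  have hII : IntervalIntegrable (fun c : ℝ => c ^ (s - 1)) volume 0 t :=
    intervalIntegral.intervalIntegrable_rpow' (by linarith)
  have hint : IntegrableOn (fun c : ℝ => c ^ (s - 1)) (Set.Ioo 0 t) :=
    ((intervalIntegrable_iff_integrableOn_Ioc_of_le ht.le).1 hII).mono_set Set.Ioo_subset_Ioc_self
  have hval : ∫ c in Set.Ioo 0 t, c ^ (s - 1) = t ^ s / s := by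
    rw [← integral_Ioc_eq_integral_Ioo, ← intervalIntegral.integral_of_le ht.le,
      integral_rpow (Or.inl (by linarith)), sub_add_cancel, zero_rpow hs.ne', sub_zero]
  calc _ = ∫⁻ c in Set.Ioo 0 t,
        ENNReal.ofReal (s * lam ^ (s - 1) / Gamma (s + 1) * c ^ (s - 1)) := by
        refine setLIntegral_congr_fun measurableSet_Ioo fun c hc => ?_
        rw [mul_rpow hc.1.le hlam.le]
        congr 1
        ring
    _ = _ := by
        rw [← ofReal_integral_eq_lintegral_ofReal (hint.const_mul _), integral_const_mul, hval,
          ← ENNReal.ofReal_mul (by positivity), mul_rpow ht.le hlam.le, rpow_sub_one hlam.ne']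
        · congr 1
          field_simp
        · filter_upwards [ae_restrict_mem measurableSet_Ioo] with c hc
          have := hc.1
          simp only [Pi.zero_apply]
          positivity

lemma lintegral_volterraDerivENN_le {M t lam : ℝ} (hM : 1 ≤ M) (ht : 0 < t) (hlam : 0 < lam)
    (h : t * lam ≤ M) :
    ∫⁻ c in Set.Ioo 0 t, volterraDerivENN (c * lam) ≤
      ENNReal.ofReal (exp (exp 2 * M) / (1 + logPlus (1 / (t * lam))) / lam) := by
  unfold volterraDerivENN
  rw [lintegral_lintegral_swap]
  · rw [div_eq_mul_inv _ lam,
      ENNReal.ofReal_mul (by have := logPlus_nonneg (1 / (t * lam)); positivity)]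
    refine le_trans ?_ (mul_le_mul_left
      (lintegral_one_add_mul_rpow_div_Gamma_le hM (mul_pos ht hlam) h) _)
    rw [← lintegral_mul_const' _ _ ENNReal.ofReal_ne_top]
    refine setLIntegral_mono' measurableSet_Ioi fun s hs => ?_
    have hs' : (0 : ℝ) < s := hs
    have hΓ : 0 < Gamma (s + 1) := Gamma_pos_of_pos (by linarith)
    have : 0 < (t * lam) ^ s := by positivity
    rw [lintegral_mul_rpow_sub_one hs' ht hlam]
    gcongr
    nlinarith
  · exact (measurable_volterraDeriv_integrand.comp
      (g := fun p : ℝ × ℝ => ENNReal.ofReal (p.2 * p.1 ^ (p.2 - 1) / Gamma (p.2 + 1)))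
      (f := fun p : ℝ × ℝ => (p.1 * lam, p.2)) (by fun_prop)).aemeasurable

/-- For a fixed `a`, the function `r⁻¹ exp (-a / r)` is increasing on `(0, a]`. -/
lemma inv_mul_exp_neg_div_le {a r m : ℝ} (hr : 0 < r) (hrm : r ≤ m) (hma : m ≤ a) :
    r⁻¹ * exp (-(a / r)) ≤ m⁻¹ * exp (-(a / m)) := by
  have hm : 0 < m := hr.trans_le hrm
  have hz : m⁻¹ ≤ r⁻¹ := inv_anti₀ hr hrm
  have h1 : r⁻¹ ≤ m⁻¹ * exp (a * (r⁻¹ - m⁻¹)) := by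
    calc r⁻¹ = m⁻¹ * (m * (r⁻¹ - m⁻¹) + 1) := by field_simp; ring
      _ ≤ m⁻¹ * (a * (r⁻¹ - m⁻¹) + 1) := by
        have : 0 ≤ r⁻¹ - m⁻¹ := by linarith
        gcongr
      _ ≤ _ := by
        gcongr
        exact add_one_le_exp _
  calc r⁻¹ * exp (-(a / r)) ≤ m⁻¹ * exp (a * (r⁻¹ - m⁻¹)) * exp (-(a / r)) := by gcongr
    _ = _ := by
      rw [mul_assoc, ← exp_add]
      congr 2
      rw [div_eq_mul_inv, div_eq_mul_inv]
      ring

lemma lintegral_inv_mul_exp_neg_div_le {a t : ℝ} (ha : 0 < a) (ht : 0 < t) :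
    ∫⁻ r in Set.Ioo 0 t, ENNReal.ofReal (r⁻¹ * exp (-(a / r))) ≤
      ENNReal.ofReal (exp (-(a / t)) + logPlus (t / a)) := by
  have hsmall : ∀ m, 0 < m → m ≤ a →
      ∫⁻ r in Set.Ioc 0 m, ENNReal.ofReal (r⁻¹ * exp (-(a / r))) ≤
        ENNReal.ofReal (exp (-(a / m))) := by
    intro m hm hma
    calc _ ≤ ∫⁻ _ in Set.Ioc 0 m, ENNReal.ofReal (m⁻¹ * exp (-(a / m))) :=
          setLIntegral_mono' measurableSet_Ioc fun r hr =>
            ENNReal.ofReal_le_ofReal (inv_mul_exp_neg_div_le hr.1 hr.2 hma)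
      _ = _ := by
          rw [setLIntegral_const, Real.volume_Ioc, ← ENNReal.ofReal_mul (by positivity)]
          congr 1
          field_simp
          ring
  rw [ENNReal.ofReal_add (exp_pos _).le (logPlus_nonneg _)]
  rcases le_or_gt t a with hta | hat
  · exact ((lintegral_mono_set Set.Ioo_subset_Ioc_self).trans (hsmall t ht hta)).trans le_self_add
  · have hsub : Set.Ioo 0 t ⊆ Set.Ioc 0 a ∪ Set.Ioc a t := by
      rw [Set.Ioc_union_Ioc_eq_Ioc ha.le hat.le]
      exact Set.Ioo_subset_Ioc_self
    refine (lintegral_mono_set hsub).trans ((lintegral_union_le _ _ _).trans (add_le_add ?_ ?_))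
    · refine (hsmall a ha le_rfl).trans (ENNReal.ofReal_le_ofReal ?_)
      gcongr
    · have hII : IntervalIntegrable (fun r : ℝ => r⁻¹) volume a t := by
        refine intervalIntegral.intervalIntegrable_inv (fun r hr => ?_) continuousOn_id
        rw [Set.uIcc_of_le hat.le] at hr
        exact (ha.trans_le hr.1).ne'
      have hint := (intervalIntegrable_iff_integrableOn_Ioc_of_le hat.le).1 hII
      calc _ ≤ ∫⁻ r in Set.Ioc a t, ENNReal.ofReal r⁻¹ := by
            refine setLIntegral_mono' measurableSet_Ioc fun r hr => ENNReal.ofReal_le_ofReal ?_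
            have hr0 : 0 < r := ha.trans hr.1
            refine mul_le_of_le_one_right (by positivity) (exp_le_one_iff.2 ?_)
            have : 0 < a / r := by positivity
            linarith
        _ = ENNReal.ofReal (log (t / a)) := by
            rw [← ofReal_integral_eq_lintegral_ofReal hint, ← intervalIntegral.integral_of_le hat.le,
              integral_inv_of_pos ha ht]
            filter_upwards [ae_restrict_mem measurableSet_Ioc] with r hr
            exact inv_nonneg.2 (ha.trans hr.1).le
        _ ≤ _ := ENNReal.ofReal_le_ofReal (le_max_left _ _)

lemma enorm_gauss2 {r : ℝ} (hr : 0 < r) (x : EuclideanSpace ℝ (Fin 2)) :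
    ‖gauss2 r x‖ₑ =
      ENNReal.ofReal (1 / (2 * π)) * ENNReal.ofReal (r⁻¹ * exp (-(‖x‖ ^ 2 / 2 / r))) := by
  rw [gauss2, Real.enorm_of_nonneg (by positivity), ← ENNReal.ofReal_mul (by positivity)]
  congr 1
  rw [div_div]
  field_simp

lemma lintegral_enorm_gauss2_le {x : EuclideanSpace ℝ (Fin 2)} (hx : x ≠ 0) {t : ℝ}
    (ht : 0 < t) :
    ∫⁻ r in Set.Ioo 0 t, ‖gauss2 r x‖ₑ ≤
      ENNReal.ofReal (1 / (2 * π) *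
        (exp (-(‖x‖ ^ 2 / (2 * t))) + logPlus (2 * t / ‖x‖ ^ 2))) := by
  have hx' : 0 < ‖x‖ := norm_pos_iff.2 hx
  have h := lintegral_inv_mul_exp_neg_div_le (a := ‖x‖ ^ 2 / 2) (by positivity) ht
  rw [show ‖x‖ ^ 2 / 2 / t = ‖x‖ ^ 2 / (2 * t) by rw [div_div],
    show t / (‖x‖ ^ 2 / 2) = 2 * t / ‖x‖ ^ 2 by field_simp] at h
  rw [ENNReal.ofReal_mul (by positivity)]
  refine le_trans (le_of_eq ?_) (mul_le_mul_right h _)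
  rw [← lintegral_const_mul' _ _ ENNReal.ofReal_ne_top]
  exact setLIntegral_congr_fun measurableSet_Ioo fun r hr => enorm_gauss2 hr.1 x

lemma enorm_gauss2_le {x : EuclideanSpace ℝ (Fin 2)} {r t : ℝ} (ht : 0 < t) (hr : t / 3 ≤ r)
    (hrt : r ≤ t) :
    ‖gauss2 r x‖ₑ ≤
      ENNReal.ofReal (3 / t * (1 / (2 * π) *
        (exp (-(‖x‖ ^ 2 / (2 * t))) + logPlus (2 * t / ‖x‖ ^ 2)))) := by
  have hr0 : 0 < r := by linarith
  rw [gauss2, Real.enorm_of_nonneg (by positivity)]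
  refine ENNReal.ofReal_le_ofReal ?_
  have h1 : 1 / (2 * π * r) ≤ 3 / t * (1 / (2 * π)) := by
    rw [div_mul_div_comm, mul_one, div_le_div_iff₀ (by positivity) (by positivity)]
    nlinarith [pi_pos]
  rw [← mul_assoc]
  refine mul_le_mul h1 ?_ (exp_pos _).le (by positivity)
  refine le_trans ?_ (le_add_of_nonneg_right (logPlus_nonneg _))
  gcongr

lemma volterraDerivENN_le_of_third {M t lam c : ℝ} (hM : 1 ≤ M) (hlam : 0 < lam)
    (h : t * lam ≤ M) (ht : 0 < t) (hc : t / 3 ≤ c) (hct : c ≤ t) :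
    volterraDerivENN (c * lam) ≤
      ENNReal.ofReal (3 / t * (exp (exp 2 * M) / (1 + logPlus (1 / (t * lam))) / lam)) := by
  have hc0 : 0 < c := by linarith
  have hle : c * lam ≤ t * lam := by gcongr
  refine (volterraDerivENN_le hM (by positivity) (hle.trans h)).trans
    (ENNReal.ofReal_le_ofReal ?_)
  have hℓ := logPlus_nonneg (1 / (t * lam))
  have hmono : logPlus (1 / (t * lam)) ≤ logPlus (1 / (c * lam)) := by
    unfold logPlus
    gcongr
  have hdiv : 1 / c ≤ 3 / t := by
    rw [div_le_div_iff₀ hc0 ht]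
    linarith
  calc exp (exp 2 * M) / (1 + logPlus (1 / (c * lam))) / (c * lam)
      ≤ exp (exp 2 * M) / (1 + logPlus (1 / (t * lam))) / (c * lam) := by gcongr
    _ = 1 / c * (exp (exp 2 * M) / (1 + logPlus (1 / (t * lam))) / lam) := by field_simp
    _ ≤ _ := by gcongr

lemma measurable_gauss2 (x : EuclideanSpace ℝ (Fin 2)) : Measurable fun r => gauss2 r x := by
  unfold gauss2
  fun_prop

open Set in
/-- A convolution-type double integral over the triangle `0 < r < s < t` is controlled when, at
each point, one of the three factors is bounded by a constant. -/
lemma lintegral_triangle_le {t : ℝ} {p n q : ℝ → ENNReal} (hp : Measurable p) (hn : Measurable n)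
    (hq : Measurable q) {p₀ n₀ q₀ : ENNReal} (hp₀ : ∀ r, t / 3 ≤ r → r ≤ t → p r ≤ p₀)
    (hn₀ : ∀ r, t / 3 ≤ r → r ≤ t → n r ≤ n₀) (hq₀ : ∀ r, t / 3 ≤ r → r ≤ t → q r ≤ q₀) :
    ∫⁻ r in Ioo 0 t, ∫⁻ s in Ioo r t, p r * n (s - r) * q (t - s) ≤
      p₀ * (∫⁻ r in Ioo 0 t, n r) * (∫⁻ r in Ioo 0 t, q r) +
      (∫⁻ r in Ioo 0 t, p r) * n₀ * (∫⁻ r in Ioo 0 t, q r) +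
      (∫⁻ r in Ioo 0 t, p r) * (∫⁻ r in Ioo 0 t, n r) * q₀ := by
  set P := (Ioo 0 t).indicator p with hP
  set N := (Ioo 0 t).indicator n with hN
  set Q := (Ioo 0 t).indicator q with hQ
  have hPm : Measurable P := hp.indicator measurableSet_Ioo
  have hNm : Measurable N := hn.indicator measurableSet_Ioo
  have hQm : Measurable Q := hq.indicator measurableSet_Ioo
  simp only [← lintegral_indicator measurableSet_Ioo (f := n),
    ← lintegral_indicator measurableSet_Ioo (f := q),
    ← lintegral_indicator measurableSet_Ioo (f := p)]
  rw [← hP, ← hN, ← hQ]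
  have hbound : ∫⁻ r in Ioo 0 t, ∫⁻ s in Ioo r t, p r * n (s - r) * q (t - s) ≤
      ∫⁻ r, ∫⁻ s, (p₀ * N (s - r) * Q (t - s) + P r * n₀ * Q (t - s) + P r * N (s - r) * q₀) := by
    refine le_trans (setLIntegral_mono' measurableSet_Ioo fun r hr => ?_)
      (setLIntegral_le_lintegral _ _)
    refine le_trans (setLIntegral_mono' measurableSet_Ioo fun s hs => ?_)
      (setLIntegral_le_lintegral _ _)
    obtain ⟨hr0, hrt⟩ := hr
    obtain ⟨hrs, hst⟩ := hs
    have e1 : P r = p r := indicator_of_mem (mem_Ioo.2 ⟨hr0, hrt⟩) _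
    have e2 : N (s - r) = n (s - r) := indicator_of_mem (mem_Ioo.2 ⟨by linarith, by linarith⟩) _
    have e3 : Q (t - s) = q (t - s) := indicator_of_mem (mem_Ioo.2 ⟨by linarith, by linarith⟩) _
    rw [e1, e2, e3]
    rcases le_or_gt (t / 3) r with h | h
    · refine le_trans ?_ (le_self_add.trans le_self_add)
      gcongr
      exact hp₀ r h hrt.le
    rcases le_or_gt (t / 3) (s - r) with h' | h'
    · refine le_trans ?_ (le_add_self.trans le_self_add)
      gcongr
      exact hn₀ _ h' (by linarith)
    · refine le_trans ?_ le_add_self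
      gcongr
      exact hq₀ _ (by linarith) (by linarith)
  refine hbound.trans (le_of_eq ?_)
  have hshift : ∀ r, ∫⁻ s, N (s - r) = ∫⁻ s, N s := fun r => lintegral_sub_right_eq_self N r
  have hQt : ∫⁻ s, Q (t - s) = ∫⁻ s, Q s := lintegral_sub_left_eq_self Q t
  have hNt : ∀ s, ∫⁻ r, N (s - r) = ∫⁻ r, N r := fun s => lintegral_sub_left_eq_self N s
  have m1 : Measurable fun z : ℝ × ℝ => p₀ * N (z.2 - z.1) * Q (t - z.2) := by fun_prop
  have m2 : Measurable fun z : ℝ × ℝ => P z.1 * n₀ * Q (t - z.2) := by fun_prop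
  have m3 : Measurable fun z : ℝ × ℝ => P z.1 * N (z.2 - z.1) * q₀ := by fun_prop
  have i1 : ∫⁻ r, ∫⁻ s, p₀ * N (s - r) * Q (t - s) = p₀ * (∫⁻ r, N r) * ∫⁻ r, Q r := by
    rw [lintegral_lintegral_swap m1.aemeasurable]
    have : ∀ s, ∫⁻ r, p₀ * N (s - r) * Q (t - s) = p₀ * (∫⁻ r, N r) * Q (t - s) := fun s => by
      rw [lintegral_mul_const _ (by fun_prop), lintegral_const_mul _ (by fun_prop), hNt]
    simp only [this]
    rw [lintegral_const_mul _ (by fun_prop), hQt]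
  have i2 : ∫⁻ r, ∫⁻ s, P r * n₀ * Q (t - s) = (∫⁻ r, P r) * n₀ * ∫⁻ r, Q r := by
    have : ∀ r, ∫⁻ s, P r * n₀ * Q (t - s) = P r * n₀ * ∫⁻ s, Q s := fun r => by
      rw [lintegral_const_mul _ (by fun_prop), hQt]
    simp only [this]
    rw [lintegral_mul_const _ (by fun_prop), lintegral_mul_const _ (by fun_prop)]
  have i3 : ∫⁻ r, ∫⁻ s, P r * N (s - r) * q₀ = (∫⁻ r, P r) * (∫⁻ r, N r) * q₀ := by
    have : ∀ r, ∫⁻ s, P r * N (s - r) * q₀ = P r * (∫⁻ s, N s) * q₀ := fun r => by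
      rw [lintegral_mul_const _ (by fun_prop), lintegral_const_mul _ (by fun_prop), hshift]
    simp only [this]
    rw [lintegral_mul_const _ (by fun_prop), lintegral_mul_const _ (by fun_prop)]
  have a2 : Measurable fun r => ∫⁻ s, P r * n₀ * Q (t - s) := m2.lintegral_prod_right'
  have a3 : Measurable fun r => ∫⁻ s, P r * N (s - r) * q₀ := m3.lintegral_prod_right'
  rw [← i1, ← i2, ← i3, ← lintegral_add_right _ a2, ← lintegral_add_right _ a3]
  refine lintegral_congr fun r => ?_
  rw [lintegral_add_right _ (by fun_prop), lintegral_add_right _ (by fun_prop)]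

/-- For every `L > 0` there is `C_L > 0` such that for all nonzero `x, y ∈ ℝ²` and `t, λ > 0`
with `tλ ≤ L`:
`h_t^λ(x,y) ≤ (C_L/t)(1/(1+log⁺(1/(λt))))(e^{−|x|²/(2t)}+log⁺(2t/|x|²))(e^{−|y|²/(2t)}+log⁺(2t/|y|²))`. -/
theorem hKer_decoupled_upper_bound (L : ℝ) (hL : 0 < L) :
    ∃ C > 0, ∀ (x y : EuclideanSpace ℝ (Fin 2)) (t lam : ℝ),
      x ≠ 0 → y ≠ 0 → 0 < t → 0 < lam → t * lam ≤ L →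
      hKer t lam x y ≤
        (C / t) * (1 / (1 + logPlus (1 / (lam * t)))) *
          (Real.exp (-(‖x‖ ^ 2 / (2 * t))) + logPlus (2 * t / ‖x‖ ^ 2)) *
          (Real.exp (-(‖y‖ ^ 2 / (2 * t))) + logPlus (2 * t / ‖y‖ ^ 2)) := by
  set M := max L 1
  have hM : 1 ≤ M := le_max_right _ _
  set K := exp (exp 2 * M) with hK
  have hKpos : 0 < K := exp_pos _
  refine ⟨9 * K / (2 * π), by positivity, fun x y t lam hx hy ht hlam hL => ?_⟩
  have htM : t * lam ≤ M := hL.trans (le_max_left _ _)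
  rw [mul_comm lam t]
  have hℓ := logPlus_nonneg (1 / (t * lam))
  have hFx := logPlus_nonneg (2 * t / ‖x‖ ^ 2)
  have hFy := logPlus_nonneg (2 * t / ‖y‖ ^ 2)
  have hp₀ := fun r => enorm_gauss2_le (x := x) (r := r) ht
  have hq₀ := fun r => enorm_gauss2_le (x := y) (r := r) ht
  have hn₀ := fun c => volterraDerivENN_le_of_third (c := c) hM hlam htM ht
  have hP := lintegral_enorm_gauss2_le hx ht
  have hQ := lintegral_enorm_gauss2_le hy ht
  have hN := lintegral_volterraDerivENN_le hM ht hlam htM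
  set F := exp (-(‖x‖ ^ 2 / (2 * t))) + logPlus (2 * t / ‖x‖ ^ 2)
  set G := exp (-(‖y‖ ^ 2 / (2 * t))) + logPlus (2 * t / ‖y‖ ^ 2)
  have hF0 : 0 < F := by positivity
  have hG0 : 0 < G := by positivity
  set V := exp (exp 2 * M) / (1 + logPlus (1 / (t * lam))) / lam with hV
  have hV0 : 0 < V := by positivity
  set I := ∫ r in Set.Ioo (0 : ℝ) t, ∫ s in Set.Ioo r t,
    gauss2 r x * volterraDeriv ((s - r) * lam) * gauss2 (t - s) y
  have hnorm : ‖I‖ₑ ≤ ∫⁻ r in Set.Ioo (0 : ℝ) t, ∫⁻ s in Set.Ioo r t,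
      ‖gauss2 r x‖ₑ * volterraDerivENN ((s - r) * lam) * ‖gauss2 (t - s) y‖ₑ := by
    refine (enorm_integral_le_lintegral_enorm _).trans (lintegral_mono fun r => ?_)
    refine (enorm_integral_le_lintegral_enorm _).trans
      (setLIntegral_mono' measurableSet_Ioo fun s hs => ?_)
    rw [enorm_mul, enorm_mul]
    gcongr
    exact enorm_volterraDeriv_le (mul_pos (sub_pos.2 hs.1) hlam)
  have htri := lintegral_triangle_le (t := t) (measurable_gauss2 x).enorm
    (measurable_volterraDerivENN.comp (measurable_id.mul_const lam)) (measurable_gauss2 y).enorm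
    hp₀ hn₀ hq₀
  have hbound : ‖I‖ₑ ≤ ENNReal.ofReal (9 / t * (1 / (2 * π) * F) * V * (1 / (2 * π) * G)) := by
    refine (hnorm.trans htri).trans ?_
    refine (add_le_add (add_le_add (mul_le_mul' (mul_le_mul' le_rfl hN) hQ)
      (mul_le_mul' (mul_le_mul' hP le_rfl) hQ)) (mul_le_mul' (mul_le_mul' hP hN) le_rfl)).trans
      (le_of_eq ?_)
    simp (discharger := positivity) only [← ENNReal.ofReal_mul, ← ENNReal.ofReal_add]
    congr 1
    ring
  have hIle : I ≤ 9 / t * (1 / (2 * π) * F) * V * (1 / (2 * π) * G) := by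
    rw [Real.enorm_eq_ofReal_abs, ENNReal.ofReal_le_ofReal_iff (by positivity)] at hbound
    exact (le_abs_self I).trans hbound
  calc hKer t lam x y = 2 * π * lam * I := rfl
    _ ≤ 2 * π * lam * (9 / t * (1 / (2 * π) * F) * V * (1 / (2 * π) * G)) := by gcongr
    _ = _ := by
      rw [hV, ← hK]
      field_simp
end
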